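/- arXiv:1810.12102 — 8 statements merged into one kernel-verified Lean document; each statement's English description precedes it below -/
import Mathlib

section
/- Let n be a positive odd integer and let x be an integer with gcd(x(1−x), n) = 1. Then (−1)^{#{k : 1 ≤ k < n/2 and {kx}_n > k}} = ((2x(1−x))/n), where (·/n) is the Jacobi symbol. -/
/-- The sum of `⌊k * a / n⌋` over the integers `1 ≤ k ≤ n / 2`. -/
def halfFloorSum (a : ℤ) (n : ℕ) : ℤ :=
  ∑ k ∈ Finset.Ico 1 (n / 2).succ, ((k : ℤ) * a) / (n : ℤ)

theorem sum_mul_div_eq_sum_indicator {p q : ℕ} (hp : 0 < p) :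
    ∑ a ∈ Finset.Ico 1 (p / 2).succ, a * q / p =
      ∑ a ∈ Finset.Ico 1 (p / 2).succ, ∑ b ∈ Finset.Ico 1 (q / 2).succ,
        if b * p ≤ a * q then 1 else 0 := by
  refine Finset.sum_congr rfl fun a ha => ?_
  have hle : a * q / p ≤ q / 2 :=
    calc
      a * q / p ≤ p / 2 * q / p := by
        have := Nat.le_of_lt_succ (Finset.mem_Ico.mp ha).2
        gcongr
      _ ≤ q / 2 := Nat.div_mul_div_le_div _ _ _
  rw [ZMod.div_eq_filter_card hp hle, Finset.card_filter]

theorem sum_mul_div_add_sum_mul_div_of_coprime {p q : ℕ} (hp : 0 < p) (hq : 0 < q)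
    (h : Nat.Coprime p q) :
    ∑ a ∈ Finset.Ico 1 (p / 2).succ, a * q / p + ∑ b ∈ Finset.Ico 1 (q / 2).succ, b * p / q =
      p / 2 * (q / 2) := by
  rw [sum_mul_div_eq_sum_indicator hp, sum_mul_div_eq_sum_indicator hq,
    Finset.sum_comm (s := Finset.Ico 1 (q / 2).succ), ← Finset.sum_add_distrib]
  have hone : ∀ a ∈ Finset.Ico 1 (p / 2).succ,
      (∑ b ∈ Finset.Ico 1 (q / 2).succ, if b * p ≤ a * q then 1 else 0) +
        (∑ b ∈ Finset.Ico 1 (q / 2).succ, if a * q ≤ b * p then 1 else 0) = q / 2 := by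
    intro a ha
    rw [← Finset.sum_add_distrib, Finset.sum_congr rfl (g := fun _ => 1)]
    · simp
    · intro b hb
      have hne : b * p ≠ a * q := by
        intro heq
        have hdvd : p ∣ a := h.dvd_of_dvd_mul_right ⟨b, by rw [← heq, mul_comm]⟩
        rw [Finset.mem_Ico] at ha
        have := Nat.le_of_dvd (by omega) hdvd
        omega
      split_ifs <;> omega
  rw [Finset.sum_congr rfl hone]
  simp

theorem halfFloorSum_natCast (q p : ℕ) :
    halfFloorSum q p = ((∑ a ∈ Finset.Ico 1 (p / 2).succ, a * q / p : ℕ) : ℤ) := by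
  simp [halfFloorSum]

theorem halfFloorSum_add_mul (a c : ℤ) {n : ℕ} (hn : 0 < n) :
    halfFloorSum (a + n * c) n =
      halfFloorSum a n + c * ∑ k ∈ Finset.Ico 1 (n / 2).succ, (k : ℤ) := by
  have hn' : (n : ℤ) ≠ 0 := by positivity
  rw [halfFloorSum, halfFloorSum, Finset.mul_sum, ← Finset.sum_add_distrib]
  refine Finset.sum_congr rfl fun k _ => ?_
  rw [show (k : ℤ) * (a + n * c) = k * a + c * k * n by ring, Int.add_mul_ediv_right _ _ hn']

theorem not_dvd_mul_of_mem_Ico_half {a : ℤ} {n k : ℕ} (h : Int.gcd a n = 1)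
    (hk : k ∈ Finset.Ico 1 (n / 2).succ) : ¬ (n : ℤ) ∣ k * a := by
  intro hdvd
  have hcop : IsCoprime (n : ℤ) a := (Int.isCoprime_iff_gcd_eq_one.mpr h).symm
  have := Int.natCast_dvd_natCast.mp (hcop.dvd_of_dvd_mul_right hdvd)
  rw [Finset.mem_Ico] at hk
  have := Nat.le_of_dvd (by omega) this
  omega

theorem halfFloorSum_neg {a : ℤ} {n : ℕ} (hn : 0 < n) (h : Int.gcd a n = 1) :
    halfFloorSum (-a) n = -halfFloorSum a n - (n / 2 : ℕ) := by
  have hterm : ∀ k ∈ Finset.Ico 1 (n / 2).succ,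
      ((k : ℤ) * -a) / (n : ℤ) = -(((k : ℤ) * a) / (n : ℤ)) - 1 := by
    intro k hk
    have hnd := not_dvd_mul_of_mem_Ico_half h hk
    have hr : 0 < ((k : ℤ) * a) % n :=
      lt_of_le_of_ne (Int.emod_nonneg _ (by positivity))
        fun h0 => hnd (Int.dvd_of_emod_eq_zero h0.symm)
    have hr' : ((k : ℤ) * a) % n < n := Int.emod_lt_of_pos _ (by positivity)
    have hdiv := Int.emod_add_mul_ediv ((k : ℤ) * a) n
    rw [Int.ediv_eq_iff_of_pos (by positivity)]
    constructor <;> nlinarith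
  rw [halfFloorSum, halfFloorSum, Finset.sum_congr rfl hterm, Finset.sum_sub_distrib]
  simp

/-- Eisenstein's lemma for Jacobi symbols. -/
theorem negOnePow_halfFloorSum_of_odd {n : ℕ} (hn : Odd n) {a : ℤ} (ha : Odd a)
    (h : Int.gcd a n = 1) : ((halfFloorSum a n).negOnePow : ℤ) = jacobiSym a n := by
  induction n using Nat.strong_induction_on generalizing a with
  | _ n ih =>
  have hn0 := hn.pos
  have hperiod : ∀ b c : ℤ, ((halfFloorSum (b + n * (2 * c)) n).negOnePow : ℤ) =
      (halfFloorSum b n).negOnePow := by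
    intro b c
    rw [halfFloorSum_add_mul _ _ hn0, mul_assoc, Int.negOnePow_add, Int.negOnePow_two_mul,
      mul_one]
  have hjperiod : ∀ b c : ℤ, jacobiSym (b + n * (2 * c)) n = jacobiSym b n := fun b c =>
    jacobiSym.mod_left' (by simp)
  have hgcd : ∀ b c : ℤ, Int.gcd (b + n * (2 * c)) n = Int.gcd b n := fun b c => by simp
  rcases Nat.eq_or_lt_of_le (Nat.succ_le_of_lt hn0) with h1 | h1
  · subst h1
    simp [halfFloorSum]
  have hsmall : ∀ b : ℕ, Odd b → b < n → Int.gcd b n = 1 →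
      ((halfFloorSum b n).negOnePow : ℤ) = jacobiSym b n := by
    intro b hb hbn hcop
    have hcop' : Nat.Coprime n b := by
      rw [Int.gcd_natCast_natCast] at hcop
      exact Nat.Coprime.symm hcop
    have hrec := sum_mul_div_add_sum_mul_div_of_coprime hn0 hb.pos hcop'
    have hsum : halfFloorSum b n = ((b / 2 * (n / 2) : ℕ) : ℤ) - halfFloorSum n b := by
      rw [halfFloorSum_natCast, halfFloorSum_natCast, mul_comm, ← hrec]
      push_cast
      ring
    rw [jacobiSym.quadratic_reciprocity hb hn, hsum, Int.negOnePow_sub, Units.val_mul,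
      Int.coe_negOnePow_natCast,
      ih b hbn hb (by exact_mod_cast hn) (by rw [Int.gcd_comm]; exact hcop)]
  obtain ⟨b, c, hb, hbn, hab⟩ : ∃ (b : ℕ) (c : ℤ), Odd b ∧ b < n ∧
      (a = b + n * (2 * c) ∨ a = -b + n * (2 * c)) := by
    have hr0 : 0 ≤ a % (2 * n) := Int.emod_nonneg _ (by positivity)
    have hr1 : a % (2 * n) < 2 * n := Int.emod_lt_of_pos _ (by positivity)
    have hdiv := Int.emod_add_mul_ediv a (2 * n)
    have hodd : Odd (a % (2 * n)) := by
      rw [Int.odd_iff] at ha ⊢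
      rwa [Int.emod_emod_of_dvd _ (dvd_mul_right 2 _)]
    have hne : a % (2 * n) ≠ n := by
      intro heq
      have hdvd : (n : ℤ) ∣ a := ⟨1 + 2 * (a / (2 * n)), by linear_combination heq - hdiv⟩
      have := Int.gcd_eq_right (Nat.cast_nonneg n) hdvd
      omega
    generalize a % (2 * n) = r at *
    generalize a / (2 * n) = c at *
    lift r to ℕ using hr0
    rw [Int.odd_coe_nat] at hodd
    rcases lt_or_gt_of_ne hne with hlt | hgt
    · exact ⟨r, c, hodd, by exact_mod_cast hlt, Or.inl (by linear_combination -hdiv)⟩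
    · have hle : r ≤ 2 * n := by omega
      refine ⟨2 * n - r, c + 1, ?_, by omega, Or.inr ?_⟩
      · exact Nat.Even.sub_odd hle (even_two_mul n) hodd
      · push_cast [hle]
        linear_combination -hdiv
  rcases hab with rfl | rfl
  · rw [hperiod, hjperiod]
    exact hsmall b hb hbn (by rwa [hgcd] at h)
  · have hcop : Int.gcd b n = 1 := by
      rw [hgcd, Int.neg_gcd] at h
      exact h
    rw [hperiod, hjperiod, halfFloorSum_neg hn0 hcop, jacobiSym.neg _ hn, Int.negOnePow_sub,
      Int.negOnePow_neg, Units.val_mul, hsmall b hb hbn hcop, Int.coe_negOnePow_natCast,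
      ZMod.χ₄_eq_neg_one_pow (Nat.odd_iff.mp hn), mul_comm]

theorem negOnePow_sum_Ico_half {n : ℕ} (hn : Odd n) :
    ((∑ k ∈ Finset.Ico 1 (n / 2).succ, (k : ℤ)).negOnePow : ℤ) = jacobiSym 2 n := by
  have hn0 := hn.pos
  have hzero : halfFloorSum 2 n = 0 := by
    refine Finset.sum_eq_zero fun k hk => ?_
    obtain ⟨m, rfl⟩ := hn
    rw [Finset.mem_Ico] at hk
    exact Int.ediv_eq_zero_of_lt (by positivity) (by push_cast; omega)
  have hodd : Odd (2 + (n : ℤ) * 1) := by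
    obtain ⟨m, rfl⟩ := hn
    exact ⟨m + 1, by push_cast; ring⟩
  have hgcd : Int.gcd (2 + (n : ℤ) * 1) n = 1 := by
    have : Int.gcd ((2 : ℕ) : ℤ) n = 1 := by
      rw [Int.gcd_natCast_natCast]
      exact Nat.coprime_two_left.mpr hn
    simpa using this
  have hmain := negOnePow_halfFloorSum_of_odd hn hodd hgcd
  rw [halfFloorSum_add_mul _ _ hn0, hzero, zero_add, one_mul] at hmain
  rw [hmain]
  exact jacobiSym.mod_left' (by simp)

theorem negOnePow_halfFloorSum_of_even {n : ℕ} (hn : Odd n) {a : ℤ} (ha : Even a)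
    (h : Int.gcd a n = 1) :
    ((halfFloorSum a n).negOnePow : ℤ) = jacobiSym 2 n * jacobiSym a n := by
  have hodd : Odd (a + (n : ℤ) * 1) := by
    rw [mul_one]
    exact ha.add_odd (by exact_mod_cast hn)
  have hmain := negOnePow_halfFloorSum_of_odd hn hodd (by simpa using h)
  have hmod : jacobiSym (a + n * 1) n = jacobiSym a n := jacobiSym.mod_left' (by simp)
  have htwo : jacobiSym 2 n ^ 2 = 1 := by
    rw [← negOnePow_sum_Ico_half hn, sq, ← Units.val_mul, ← Int.negOnePow_add, ← two_mul,
      Int.negOnePow_two_mul, Units.val_one]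
  rw [halfFloorSum_add_mul _ _ hn.pos, one_mul, Int.negOnePow_add, Units.val_mul,
    negOnePow_sum_Ico_half hn, hmod] at hmain
  linear_combination jacobiSym 2 n * hmain - ((halfFloorSum a n).negOnePow : ℤ) * htwo

theorem card_filter_lt_mul_emod {n : ℕ} (hn : Odd n) {x : ℤ} (h : Int.gcd (x - 1) n = 1) :
    (((Finset.Ico 1 n).filter
        (fun k => 2 * k < n ∧ (k : ℤ) < ((k : ℤ) * x) % (n : ℤ))).card : ℤ) =
      (n / 2 : ℕ) - halfFloorSum x n + halfFloorSum (x - 1) n := by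
  have hn0 : (0 : ℤ) < n := by exact_mod_cast hn.pos
  have hset : (Finset.Ico 1 n).filter
      (fun k => 2 * k < n ∧ (k : ℤ) < ((k : ℤ) * x) % (n : ℤ)) =
      (Finset.Ico 1 (n / 2).succ).filter (fun k : ℕ => (k : ℤ) < ((k : ℤ) * x) % (n : ℤ)) := by
    obtain ⟨m, rfl⟩ := hn
    ext k
    simp only [Finset.mem_filter, Finset.mem_Ico]
    constructor
    · rintro ⟨h1, h2, h3⟩
      exact ⟨by omega, h3⟩
    · rintro ⟨h1, h3⟩
      exact ⟨by omega, by omega, h3⟩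
  have hterm : ∀ k ∈ Finset.Ico 1 (n / 2).succ,
      (if (k : ℤ) < ((k : ℤ) * x) % (n : ℤ) then (1 : ℤ) else 0) =
        1 - ((k : ℤ) * x) / n + ((k : ℤ) * (x - 1)) / n := by
    intro k hk
    have hnd := not_dvd_mul_of_mem_Ico_half h hk
    have hdiv := Int.emod_add_mul_ediv ((k : ℤ) * x) n
    have hr0 : 0 ≤ ((k : ℤ) * x) % n := Int.emod_nonneg _ hn0.ne'
    have hr1 : ((k : ℤ) * x) % n < n := Int.emod_lt_of_pos _ hn0
    rw [Finset.mem_Ico] at hk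
    have hkn : (k : ℤ) < n := by omega
    have hk0 : (0 : ℤ) ≤ k := by positivity
    split_ifs with hlt
    · have : ((k : ℤ) * (x - 1)) / n = ((k : ℤ) * x) / n := by
        rw [Int.ediv_eq_iff_of_pos hn0]
        constructor <;> nlinarith
      rw [this]
      ring
    · have hne : ((k : ℤ) * x) % n ≠ k := fun heq =>
        hnd ⟨((k : ℤ) * x) / n, by linear_combination heq - hdiv⟩
      have hlt' : ((k : ℤ) * x) % n < k := lt_of_le_of_ne (not_lt.mp hlt) hne
      have : ((k : ℤ) * (x - 1)) / n = ((k : ℤ) * x) / n - 1 := by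
        rw [Int.ediv_eq_iff_of_pos hn0]
        constructor <;> nlinarith
      rw [this]
      ring
  rw [hset, Finset.card_filter]
  push_cast
  rw [Finset.sum_congr rfl hterm, Finset.sum_add_distrib, Finset.sum_sub_distrib]
  simp [halfFloorSum]

/-- Theorem 1.1, (1.3): for a positive odd integer `n` and an integer `x` with
`gcd(x(1-x), n) = 1`, we have
`(-1)^{#{1 ≤ k < n/2 : {kx}_n > k}} = ((2x(1-x))/n)` (Jacobi symbol). -/
theorem statement0 (n : ℕ) (hn : Odd n) (hn0 : 0 < n) (x : ℤ)
    (hx : Int.gcd (x * (1 - x)) n = 1) :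
    (-1 : ℤ) ^ ((Finset.Ico 1 n).filter
        (fun k => 2 * k < n ∧ (k : ℤ) < ((k : ℤ) * x) % (n : ℤ))).card
      = jacobiSym (2 * x * (1 - x)) n := by
  have hcop := Int.isCoprime_iff_gcd_eq_one.mpr hx
  have hx0 : Int.gcd x n = 1 := Int.isCoprime_iff_gcd_eq_one.mp hcop.of_mul_left_left
  have hx1 : Int.gcd (x - 1) n = 1 := by
    rw [← neg_sub, Int.neg_gcd]
    exact Int.isCoprime_iff_gcd_eq_one.mp hcop.of_mul_left_right
  rw [← Int.coe_negOnePow_natCast, card_filter_lt_mul_emod hn hx1, Int.negOnePow_add,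
    Int.negOnePow_sub, Units.val_mul, Units.val_mul, Int.coe_negOnePow_natCast,
    ← ZMod.χ₄_eq_neg_one_pow (Nat.odd_iff.mp hn), ← neg_sub x 1, jacobiSym.mul_left,
    jacobiSym.mul_left, jacobiSym.neg _ hn]
  rcases Int.even_or_odd x with hpar | hpar
  · rw [negOnePow_halfFloorSum_of_even hn hpar hx0,
      negOnePow_halfFloorSum_of_odd hn (hpar.sub_odd odd_one) hx1]
    ring
  · rw [negOnePow_halfFloorSum_of_odd hn hpar hx0,
      negOnePow_halfFloorSum_of_even hn (hpar.sub_odd odd_one) hx1]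
    ring
end

section
/- Let n be a positive odd integer and let x be an integer with gcd(x(1−x), n) = 1. Then (−1)^{#{k : 1 ≤ k < n/2, {kx}_n > n/2 and {k(1−x)}_n > n/2}} = (2/n), where (·/n) is the Jacobi symbol. -/
/-- Multiplication by a unit `x` modulo an odd `n`, followed by taking the absolute value of the
balanced residue, permutes `{1, …, (n - 1) / 2}`. -/
theorem image_natAbs_bmod_mul {n : ℕ} (hn : Odd n) {x : ℤ} (hx : IsCoprime (n : ℤ) x) :
    (Finset.Ico 1 (n / 2 + 1)).image (fun k : ℕ => (((k : ℤ) * x).bmod n).natAbs)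
      = Finset.Ico 1 (n / 2 + 1) := by
  obtain ⟨m, rfl⟩ := hn
  have hdvd (y : ℤ) : ((2 * m + 1 : ℕ) : ℤ) ∣ y - y.bmod (2 * m + 1) :=
    Int.dvd_self_sub_bmod
  have hbd (y : ℤ) : (y.bmod (2 * m + 1)).natAbs ≤ m := by
    have h1 := Int.le_bmod (x := y) (m := 2 * m + 1) (by omega)
    have h2 := Int.bmod_lt (x := y) (m := 2 * m + 1) (by omega)
    omega
  have hsmall (y : ℤ) (hy : y.natAbs < 2 * m + 1)
      (h : ((2 * m + 1 : ℕ) : ℤ) ∣ y * x) : y = 0 :=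
    Int.eq_zero_of_abs_lt_dvd (hx.dvd_of_dvd_mul_right h) (by rw [Int.abs_eq_natAbs]; omega)
  refine Finset.eq_of_subset_of_card_le (fun j hj => ?_) (Finset.card_image_of_injOn ?_).ge
  · obtain ⟨k, hk, rfl⟩ := Finset.mem_image.1 hj
    rw [Finset.mem_Ico] at hk ⊢
    have h0 : ((k : ℤ) * x).bmod (2 * m + 1) ≠ 0 := fun h => by
      have := hsmall k (by omega) (by simpa [h] using hdvd (k * x))
      omega
    have := hbd (k * x)
    omega
  · intro k hk l hl hkl
    simp only [Finset.coe_Ico, Set.mem_Ico] at hk hl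
    rcases Int.natAbs_eq_natAbs_iff.1 hkl with h | h
    · have := hsmall (k - l) (by omega) (by
        have := dvd_sub (hdvd (k * x)) (hdvd (l * x))
        rw [h] at this
        ring_nf at this ⊢
        exact this)
      omega
    · have := hsmall (k + l) (by omega) (by
        have := dvd_add (hdvd (k * x)) (hdvd (l * x))
        rw [h] at this
        ring_nf at this ⊢
        exact this)
      omega

theorem sum_natAbs_bmod_mul {n : ℕ} (hn : Odd n) {x : ℤ} (hx : IsCoprime (n : ℤ) x) :
    ∑ k ∈ Finset.Ico 1 (n / 2 + 1), (((k : ℤ) * x).bmod n).natAbs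
      = ∑ k ∈ Finset.Ico 1 (n / 2 + 1), k := by
  have himg := image_natAbs_bmod_mul hn hx
  conv_rhs => rw [← himg]
  exact (Finset.sum_image (f := fun k : ℕ => k)
    (Finset.card_image_iff.1 (congrArg Finset.card himg))).symm

/-- If two residues modulo an odd `n` add up to `k < n / 2`, then the balanced residues add up to
`k - n` or `k`, according to whether both residues exceed `n / 2` or not. -/
theorem bmod_add_bmod_eq {n k : ℕ} (hn : Odd n) (hk : 2 * k < n) {a b : ℤ} (hab : a + b = k) :
    a.bmod n + b.bmod n
      = k - n * (if (n : ℤ) < 2 * (a % n) ∧ (n : ℤ) < 2 * (b % n) then 1 else 0) := by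
  obtain ⟨m, rfl⟩ := hn
  have hn0 : (0 : ℤ) < (2 * m + 1 : ℕ) := by omega
  have ha0 := Int.emod_nonneg a hn0.ne'
  have hb0 := Int.emod_nonneg b hn0.ne'
  have ha1 := Int.emod_lt_of_pos a hn0
  have hb1 := Int.emod_lt_of_pos b hn0
  have hsum : (a % (2 * m + 1 : ℕ) + b % (2 * m + 1 : ℕ)) % (2 * m + 1 : ℕ) = k := by
    rw [← Int.add_emod, hab, Int.emod_eq_of_lt] <;> omega
  rw [Int.bmod_def, Int.bmod_def]
  generalize a % (2 * m + 1 : ℕ) = r at *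
  generalize b % (2 * m + 1 : ℕ) = s at *
  have hrs : r + s = k ∨ r + s = k + (2 * m + 1 : ℕ) := by
    rcases lt_or_ge (r + s) (2 * m + 1 : ℕ) with h | h
    · rw [Int.emod_eq_of_lt (by omega) h] at hsum
      exact .inl hsum
    · rw [← Int.sub_emod_right, Int.emod_eq_of_lt (by omega) (by omega)] at hsum
      omega
  split_ifs <;> omega

theorem jacobiSym_two_eq_neg_one_pow_sum {n : ℕ} (hn : Odd n) :
    jacobiSym 2 n = (-1) ^ ∑ k ∈ Finset.Ico 1 (n / 2 + 1), k := by
  rw [jacobiSym.at_two hn, ZMod.χ₈_nat_eq_if_mod_eight]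
  have hsum : (∑ k ∈ Finset.Ico 1 (n / 2 + 1), k) * 2 = (n / 2 + 1) * (n / 2) := by
    have h := Finset.sum_range_id_mul_two (n / 2 + 1)
    rwa [Finset.sum_range_eq_add_Ico _ (Nat.succ_pos _), zero_add] at h
  generalize ∑ k ∈ Finset.Ico 1 (n / 2 + 1), k = S at *
  obtain ⟨q, r, hr, rfl⟩ : ∃ q r, r < 8 ∧ n = 8 * q + r :=
    ⟨n / 8, n % 8, Nat.mod_lt _ (by norm_num), (Nat.div_add_mod n 8).symm⟩
  rw [show (8 * q + r) / 2 = 4 * q + r / 2 by omega] at hsum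
  rw [Nat.odd_iff] at hn
  interval_cases r <;> first | omega | skip
  all_goals
    norm_num at hsum
    ring_nf at hsum
  · rw [Even.neg_one_pow (Nat.even_iff.2 (by omega))]
    split_ifs <;> omega
  · rw [Odd.neg_one_pow (Nat.odd_iff.2 (by omega))]
    split_ifs <;> omega
  · rw [Odd.neg_one_pow (Nat.odd_iff.2 (by omega))]
    split_ifs <;> omega
  · rw [Even.neg_one_pow (Nat.even_iff.2 (by omega))]
    split_ifs <;> omega

/-- Theorem 1.1, (1.4): for a positive odd integer `n` and an integer `x` with
`gcd(x(1-x), n) = 1`, we have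
`(-1)^{#{1 ≤ k < n/2 : {kx}_n > n/2 and {k(1-x)}_n > n/2}} = (2/n)` (Jacobi symbol). -/
theorem statement1 (n : ℕ) (hn : Odd n) (hn0 : 0 < n) (x : ℤ)
    (hx : Int.gcd (x * (1 - x)) n = 1) :
    (-1 : ℤ) ^ ((Finset.Ico 1 n).filter
        (fun k => 2 * k < n ∧ (n : ℤ) < 2 * (((k : ℤ) * x) % (n : ℤ))
          ∧ (n : ℤ) < 2 * (((k : ℤ) * (1 - x)) % (n : ℤ)))).card
      = jacobiSym 2 n := by
  have hcop : IsCoprime (n : ℤ) (x * (1 - x)) := (Int.isCoprime_iff_gcd_eq_one.2 hx).symm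
  rw [IsCoprime.mul_right_iff] at hcop
  have hfilter : (Finset.Ico 1 n).filter
        (fun k : ℕ => 2 * k < n ∧ (n : ℤ) < 2 * (((k : ℤ) * x) % (n : ℤ))
          ∧ (n : ℤ) < 2 * (((k : ℤ) * (1 - x)) % (n : ℤ)))
      = (Finset.Ico 1 (n / 2 + 1)).filter (fun k : ℕ => (n : ℤ) < 2 * (((k : ℤ) * x) % (n : ℤ))
          ∧ (n : ℤ) < 2 * (((k : ℤ) * (1 - x)) % (n : ℤ))) := by
    obtain ⟨m, rfl⟩ := hn
    ext k
    simp only [Finset.mem_filter, Finset.mem_Ico, ← and_assoc]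
    refine and_congr_left fun _ => and_congr_left fun _ => ?_
    omega
  have hodd : (n : ZMod 2) = 1 := (ZMod.natCast_eq_one_iff_odd).2 hn
  have habs (y : ℤ) : ((y.natAbs : ℕ) : ZMod 2) = y := by
    rcases Int.natAbs_eq y with h | h
    · conv_rhs => rw [h, Int.cast_natCast]
    · conv_rhs => rw [h, Int.cast_neg, Int.cast_natCast, ZMod.neg_eq_self_mod_two]
  have hparity (k : ℕ) (hk : k ∈ Finset.Ico 1 (n / 2 + 1)) :
      ((((k : ℤ) * x).bmod n).natAbs : ZMod 2) + (((k : ℤ) * (1 - x)).bmod n).natAbs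
        = k - (if (n : ℤ) < 2 * (((k : ℤ) * x) % (n : ℤ))
          ∧ (n : ℤ) < 2 * (((k : ℤ) * (1 - x)) % (n : ℤ)) then 1 else 0) := by
    have h2k : 2 * k < n := by
      rw [Finset.mem_Ico] at hk
      rw [Nat.odd_iff] at hn
      omega
    have h := congrArg (Int.cast : ℤ → ZMod 2)
      (bmod_add_bmod_eq hn h2k (show (k : ℤ) * x + k * (1 - x) = k by ring))
    simpa [habs, hodd] using h
  have hsum := Finset.sum_congr rfl hparity
  rw [Finset.sum_add_distrib, Finset.sum_sub_distrib, Finset.sum_boole, ← Nat.cast_sum,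
    ← Nat.cast_sum, ← Nat.cast_sum, sum_natAbs_bmod_mul hn hcop.1, sum_natAbs_bmod_mul hn hcop.2,
    ← hfilter, CharTwo.add_self_eq_zero, eq_comm, sub_eq_zero, ZMod.natCast_eq_natCast_iff'] at hsum
  rw [jacobiSym_two_eq_neg_one_pow_sum hn, neg_one_pow_eq_pow_mod_two, ← hsum,
    ← neg_one_pow_eq_pow_mod_two]
end

section
/- Let n be a positive odd integer and let x be an integer with gcd(x(1−x), n) = 1. Then (−1)^{#{k : 1 ≤ k < n/2, {kx}_n > n/2 and {k(1−x)}_n < n/2}} = ((2x)/n), where (·/n) is the Jacobi symbol. -/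
/-- A set of representatives of the nonzero elements of an additive group modulo negation. -/
def IsHalfSystem {X : Type*} [AddCommGroup X] (S : Finset X) : Prop :=
  0 ∉ S ∧ ∀ x, x ≠ 0 → (x ∈ S ↔ -x ∉ S)

/-- The sign function that is `1` on `S` and `-1` off `S`. -/
def halfSign {X : Type*} [DecidableEq X] (S : Finset X) (x : X) : ℤ :=
  if x ∈ S then 1 else -1

/-- The sign appearing in Gauss' lemma for multiplication by `u`, relative to `S`. -/
def gaussSign {X : Type*} [AddCommGroup X] [DecidableEq X] (S : Finset X) (u : ℤ) : ℤ :=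
  ∏ x ∈ S, halfSign S (u • x)

theorem halfSign_mul_self {X : Type*} [DecidableEq X] (S : Finset X) (x : X) : halfSign S x * halfSign S x = 1 := by
  unfold halfSign; split_ifs <;> norm_num

theorem IsHalfSystem.ne_zero {X : Type*} [AddCommGroup X] {S : Finset X} (hS : IsHalfSystem S) {x : X} (hx : x ∈ S) : x ≠ 0 := by
  rintro rfl; exact hS.1 hx

section HalfSystem

variable {X : Type*} [AddCommGroup X] [DecidableEq X] {S T : Finset X} {u : ℤ}

theorem IsHalfSystem.halfSign_neg (hS : IsHalfSystem S) {x : X} (hx : x ≠ 0) :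
    halfSign S (-x) = -halfSign S x := by
  have := hS.2 x hx
  unfold halfSign
  by_cases h : x ∈ S <;> by_cases h' : -x ∈ S <;> simp_all

theorem IsHalfSystem.prod_eq_prod (hS : IsHalfSystem S) (hT : IsHalfSystem T) {f : X → ℤ}
    (hf : ∀ x, x ≠ 0 → f (-x) = f x) : ∏ x ∈ S, f x = ∏ x ∈ T, f x := by
  have aux : ∀ {A B : Finset X}, IsHalfSystem A → IsHalfSystem B → ∀ x ∈ A,
      (if x ∈ B then x else -x) ∈ B ∧
        (if (if x ∈ B then x else -x) ∈ A then (if x ∈ B then x else -x)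
          else -(if x ∈ B then x else -x)) = x := by
    intro A B hA hB x hx
    have h0 := hA.ne_zero hx
    have h1 := hA.2 x h0
    have h2 := hB.2 x h0
    by_cases h : x ∈ B
    · simp [h, hx]
    · have h3 : -x ∈ B := by by_contra h'; exact h (h2.2 h')
      simp [h, h3, h1.1 hx]
  refine Finset.prod_nbij' (fun x => if x ∈ T then x else -x) (fun x => if x ∈ S then x else -x)
    (fun x hx => (aux hS hT x hx).1) (fun x hx => (aux hT hS x hx).1)
    (fun x hx => (aux hS hT x hx).2) (fun x hx => (aux hT hS x hx).2) ?_
  intro x hx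
  split_ifs
  · rfl
  · rw [hf x (hS.ne_zero hx)]

theorem IsHalfSystem.image_zsmul (hS : IsHalfSystem S)
    (hu : Function.Bijective fun x : X => u • x) :
    IsHalfSystem (S.image fun x : X => u • x) := by
  refine ⟨fun h => ?_, fun x hx => ?_⟩
  · obtain ⟨x, hx, h⟩ := Finset.mem_image.1 h
    have : x = 0 := hu.1 (by simpa using h)
    exact hS.ne_zero hx this
  · obtain ⟨y, rfl⟩ := hu.2 x
    have hy : y ≠ 0 := by rintro rfl; simp at hx
    have h1 := hu.1.mem_finset_image (s := S) (a := y)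
    have h2 := hu.1.mem_finset_image (s := S) (a := -y)
    rw [← smul_neg, h1, h2]
    exact hS.2 y hy

theorem IsHalfSystem.prod_zsmul (hS : IsHalfSystem S)
    (hu : Function.Bijective fun x : X => u • x) {f : X → ℤ}
    (hf : ∀ x, x ≠ 0 → f (-x) = -f x) :
    ∏ x ∈ S, f (u • x) = gaussSign S u * ∏ x ∈ S, f x := by
  have h1 : ∏ x ∈ S, f (u • x) * halfSign S (u • x) = ∏ x ∈ S, f x * halfSign S x := by
    rw [← Finset.prod_image (s := S) (g := fun x : X => u • x)
      (f := fun x => f x * halfSign S x) hu.1.injOn]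
    refine (hS.image_zsmul hu).prod_eq_prod hS fun x hx => ?_
    rw [hf x hx, hS.halfSign_neg hx]; ring
  have h2 : ∏ x ∈ S, f x * halfSign S x = ∏ x ∈ S, f x :=
    Finset.prod_congr rfl fun x hx => by simp [halfSign, hx]
  rw [← h2, ← h1, gaussSign, ← Finset.prod_mul_distrib]
  refine Finset.prod_congr rfl fun x _ => ?_
  linear_combination -f (u • x) * halfSign_mul_self S (u • x)

theorem IsHalfSystem.gaussSign_eq (hS : IsHalfSystem S) (hT : IsHalfSystem T)
    (hu : Function.Bijective fun x : X => u • x) : gaussSign S u = gaussSign T u := by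
  have h1 : gaussSign T u = ∏ x ∈ T, halfSign T (u • x) * halfSign T x :=
    Finset.prod_congr rfl fun x hx => by simp [halfSign, hx]
  have h0 : ∀ x : X, x ≠ 0 → u • x ≠ 0 := fun x hx h => hx (hu.1 (by simpa using h))
  rw [h1, hT.prod_eq_prod hS, Finset.prod_mul_distrib,
    hS.prod_zsmul hu fun x hx => hT.halfSign_neg hx, mul_assoc, ← Finset.prod_mul_distrib]
  · simp [halfSign_mul_self]
  · intro x hx
    rw [smul_neg, hT.halfSign_neg hx, hT.halfSign_neg (h0 x hx)]; ring

/-- The Gauss sign is multiplicative in short exact sequences of groups of odd order. -/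
theorem gaussSign_of_exact {K Q : Type*} [AddCommGroup K] [AddCommGroup Q] [DecidableEq K]
    [DecidableEq Q] [Fintype X] [Fintype Q] (hX : Odd (Fintype.card X)) (i : K →+ X) (p : X →+ Q)
    (hi : Function.Injective i) (hp : Function.Surjective p) (hip : ∀ x, p x = 0 ↔ ∃ y, i y = x)
    {A : Finset K} {B : Finset Q} (hA : IsHalfSystem A) (hB : IsHalfSystem B)
    (hS : IsHalfSystem S) (huX : Function.Bijective fun x : X => u • x)
    (huQ : Function.Bijective fun x : Q => u • x) :
    gaussSign S u = gaussSign A u * gaussSign B u := by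
  set T : Finset X := A.image i ∪ Finset.univ.filter fun x => p x ∈ B with hTdef
  have hpi : ∀ y, p (i y) = 0 := fun y => (hip _).2 ⟨y, rfl⟩
  have memi : ∀ y, i y ∈ T ↔ y ∈ A := by
    intro y
    simp [hTdef, hpi, hB.1, hi.eq_iff]
  have memp : ∀ x, p x ≠ 0 → (x ∈ T ↔ p x ∈ B) := by
    intro x hx
    have : ¬ ∃ y ∈ A, i y = x := fun ⟨y, _, h⟩ => hx ((hip x).2 ⟨y, h⟩)
    simp [hTdef, this]
  have hT : IsHalfSystem T := by
    refine ⟨?_, fun x hx => ?_⟩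
    · rw [← map_zero i, memi]; exact hA.1
    · by_cases h : p x = 0
      · obtain ⟨y, rfl⟩ := (hip x).1 h
        rw [← map_neg, memi, memi]
        exact hA.2 y (by rintro rfl; simp at hx)
      · rw [memp x h, memp (-x) (by simpa using h), map_neg]
        exact hB.2 _ h
  have hdisj : Disjoint (A.image i) (Finset.univ.filter fun x => p x ∈ B) := by
    rw [Finset.disjoint_left]
    intro x hx hx'
    obtain ⟨y, _, rfl⟩ := Finset.mem_image.1 hx
    simp [hpi, hB.1] at hx'
  rw [hS.gaussSign_eq hT huX, gaussSign, hTdef, Finset.prod_union hdisj, ← hTdef,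
    Finset.prod_image hi.injOn]
  congr 1
  · refine Finset.prod_congr rfl fun y _ => ?_
    simp only [← map_zsmul, halfSign, memi]
  · obtain ⟨c, hc⟩ : ∃ c, ∀ q : Q, (Finset.univ.filter fun x => p x = q).card = c :=
      ⟨_, fun q => AddMonoidHom.card_fiber_eq_of_mem_range p (hp q) (hp 0)⟩
    have hcodd : Odd c := by
      have h : Fintype.card X = Fintype.card Q * c := by
        rw [← Finset.card_univ, Finset.card_eq_sum_card_fiberwise (f := p) (t := Finset.univ)
          (by simp)]
        simp [hc]
      rw [h] at hX
      exact (Nat.odd_mul.1 hX).2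
    have h1 : ∏ x ∈ Finset.univ.filter (fun x => p x ∈ B), halfSign T (u • x)
        = ∏ x ∈ Finset.univ.filter (fun x => p x ∈ B), halfSign B (u • p x) := by
      refine Finset.prod_congr rfl fun x hx => ?_
      have hx : p x ∈ B := (Finset.mem_filter.1 hx).2
      have h0 : p (u • x) ≠ 0 := by
        rw [map_zsmul]
        exact fun h => hB.ne_zero hx (huQ.1 (by simpa using h))
      simp only [← map_zsmul, halfSign, memp _ h0]
    rw [h1, ← Finset.prod_fiberwise_of_maps_to (g := p) (t := B)
      (by intro x hx; exact (Finset.mem_filter.1 hx).2)]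
    refine Finset.prod_congr rfl fun q hq => ?_
    have h2 : (Finset.univ.filter fun x => p x ∈ B).filter (fun x => p x = q)
        = Finset.univ.filter fun x => p x = q := by
      ext x; simp only [Finset.mem_filter, Finset.mem_univ, true_and]
      exact ⟨fun h => h.2, fun h => ⟨h ▸ hq, h⟩⟩
    rw [h2, Finset.prod_congr rfl (g := fun _ => halfSign B (u • q))
      (by intro x hx; rw [(Finset.mem_filter.1 hx).2]), Finset.prod_const, hc]
    unfold halfSign
    split_ifs
    · simp
    · exact hcodd.neg_one_pow

end HalfSystem

namespace ZMod

/-- The classes in `ZMod n` represented by `1 ≤ k < n / 2`. -/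
def lowerHalf (n : ℕ) [NeZero n] : Finset (ZMod n) :=
  Finset.univ.filter fun x => x ≠ 0 ∧ 2 * x.val < n

variable {n : ℕ} [NeZero n]

theorem mem_lowerHalf {x : ZMod n} : x ∈ lowerHalf n ↔ x ≠ 0 ∧ 2 * x.val < n := by
  simp [lowerHalf]

theorem val_neg_add_val {x : ZMod n} (hx : x ≠ 0) : (-x).val + x.val = n := by
  have : NeZero x := ⟨hx⟩
  have h := val_neg_of_ne_zero x
  have := x.val_lt
  omega

theorem isHalfSystem_lowerHalf (hn : Odd n) : IsHalfSystem (lowerHalf n) := by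
  refine ⟨by simp [mem_lowerHalf], fun x hx => ?_⟩
  have := val_neg_add_val hx
  obtain ⟨m, rfl⟩ := hn
  simp only [mem_lowerHalf, hx, neg_eq_zero, ne_eq, not_false_eq_true, true_and]
  omega

theorem bijective_zsmul {u : ℤ} (hu : IsCoprime u n) :
    Function.Bijective fun x : ZMod n => u • x := by
  have h : IsUnit (u : ZMod n) := by
    obtain ⟨a, b, h⟩ := hu
    refine IsUnit.of_mul_eq_one (a : ZMod n) ?_
    have := congrArg (Int.cast : ℤ → ZMod n) h
    push_cast at this
    simpa [mul_comm] using this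
  simpa only [zsmul_eq_mul] using IsUnit.isUnit_iff_mulLeft_bijective.1 h

/-- Reindexing products over the lower half by natural numbers. -/
theorem prod_lowerHalf {M : Type*} [CommMonoid M] (f : ZMod n → M) :
    ∏ x ∈ lowerHalf n, f x = ∏ k ∈ (Finset.Ico 1 n).filter (fun k => 2 * k < n), f (k : ZMod n) := by
  refine Finset.prod_nbij' (fun x => x.val) (fun k => (k : ZMod n)) ?_ ?_ ?_ ?_ ?_
  · intro x hx
    rw [mem_lowerHalf] at hx
    have := (val_ne_zero x).2 hx.1
    have := x.val_lt
    simp only [Finset.mem_filter, Finset.mem_Ico]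
    omega
  · intro k hk
    simp only [Finset.mem_filter, Finset.mem_Ico] at hk
    have h := val_cast_of_lt hk.1.2
    rw [mem_lowerHalf, ← val_ne_zero, h]
    omega
  · intro x _; simp
  · intro k hk
    simp only [Finset.mem_filter, Finset.mem_Ico] at hk
    exact val_cast_of_lt hk.1.2
  · intro x _; simp

theorem halfSign_lowerHalf {x : ZMod n} (hx : x ≠ 0) :
    halfSign (lowerHalf n) x = if 2 * x.val < n then 1 else -1 := by
  simp [halfSign, mem_lowerHalf, hx]

theorem gaussSign_prime {p : ℕ} [Fact p.Prime] (hp : Odd p) {u : ℤ} (hu : IsCoprime u p) :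
    gaussSign (lowerHalf p) u = jacobiSym u p := by
  have hb := bijective_zsmul hu
  have h0 : ∀ x : ZMod p, x ≠ 0 → u • x ≠ 0 := fun x hx h => hx (hb.1 (by simpa using h))
  have hu0 : (u : ZMod p) ≠ 0 := by simpa using h0 1 one_ne_zero
  rw [← jacobiSym.legendreSym.to_jacobiSym, gauss_lemma (by rintro rfl; revert hp; decide) hu0,
    gaussSign, prod_lowerHalf, Finset.card_filter, ← Finset.prod_pow_eq_pow_sum]
  have hpp : 2 ≤ p := (Fact.out : p.Prime).two_le
  refine Finset.prod_congr ?_ fun k hk => ?_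
  · ext k; simp only [Finset.mem_filter, Finset.mem_Ico]
    obtain ⟨m, rfl⟩ := hp
    omega
  · simp only [Finset.mem_Ico] at hk
    have hk0 : (k : ZMod p) ≠ 0 := by
      rw [← val_ne_zero, val_cast_of_lt (by omega)]; omega
    rw [halfSign_lowerHalf (h0 _ hk0), zsmul_eq_mul]
    obtain ⟨m, rfl⟩ := hp
    split_ifs <;> omega

/-- **Gauss' lemma** for the Jacobi symbol. -/
theorem gaussSign_eq_jacobiSym (N : ℕ) [hN0 : NeZero N] (hN : Odd N) {u : ℤ}
    (hu : IsCoprime u N) : gaussSign (lowerHalf N) u = jacobiSym u N := by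
  revert hN0
  induction N using induction_on_primes with
  | zero => intro hN0; exact absurd rfl hN0.out
  | one =>
    intro _
    have : lowerHalf 1 = ∅ := by ext x; simp [mem_lowerHalf, Subsingleton.elim x 0]
    simp [gaussSign, this]
  | prime_mul p a hp ih =>
    intro hN0
    have : Fact p.Prime := ⟨hp⟩
    have ha0 : NeZero a := ⟨by rintro rfl; exact hN0.out (by simp)⟩
    obtain ⟨hpo, hao⟩ := Nat.odd_mul.1 hN
    rw [Nat.cast_mul] at hu
    have hup : IsCoprime u p := hu.of_mul_right_left
    have hua : IsCoprime u a := hu.of_mul_right_right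
    let i : ZMod a →+ ZMod (p * a) := ZMod.lift a
      ⟨(AddMonoidHom.mulLeft (p : ZMod (p * a))).comp (Int.castAddHom (ZMod (p * a))), by
        simpa using (by exact_mod_cast natCast_self (p * a) :
          (p : ZMod (p * a)) * (a : ZMod (p * a)) = 0)⟩
    have hi : ∀ z : ℤ, i z = ((p * z : ℤ) : ZMod (p * a)) := fun z => by simp [i]
    let π : ZMod (p * a) →+ ZMod p := (castHom (dvd_mul_right p a) (ZMod p)).toAddMonoidHom
    have hπ : ∀ z : ℤ, π z = z := fun z => by simp [π]
    have key := gaussSign_of_exact (S := lowerHalf (p * a)) (u := u) (by rwa [ZMod.card]) i π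
      ?_ ?_ ?_ (isHalfSystem_lowerHalf hao) (isHalfSystem_lowerHalf hpo)
      (isHalfSystem_lowerHalf hN) (bijective_zsmul (by exact_mod_cast hu)) (bijective_zsmul hup)
    · rw [key, ih hao hua, gaussSign_prime hpo hup, jacobiSym.mul_right, mul_comm]
    · rw [injective_iff_map_eq_zero]
      intro y hy
      obtain ⟨z, rfl⟩ := intCast_surjective y
      rw [hi, intCast_zmod_eq_zero_iff_dvd] at hy
      rw [intCast_zmod_eq_zero_iff_dvd]
      push_cast at hy
      exact Int.dvd_of_mul_dvd_mul_left (by exact_mod_cast hp.ne_zero) hy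
    · intro q
      obtain ⟨z, rfl⟩ := intCast_surjective q
      exact ⟨z, hπ z⟩
    · intro x
      obtain ⟨z, rfl⟩ := intCast_surjective x
      rw [hπ, intCast_zmod_eq_zero_iff_dvd]
      constructor
      · rintro ⟨w, rfl⟩
        exact ⟨w, hi w⟩
      · rintro ⟨y, hy⟩
        obtain ⟨w, rfl⟩ := intCast_surjective y
        have := congrArg π hy
        rwa [hi, hπ, hπ, Int.cast_mul, Int.cast_natCast, natCast_self, zero_mul, eq_comm,
          intCast_zmod_eq_zero_iff_dvd] at this

theorem val_eq_or_of_add_eq {x y z : ZMod n} (h : x + y = z) :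
    x.val + y.val = z.val ∨ x.val + y.val = z.val + n := by
  have hx := x.val_lt
  have hy := y.val_lt
  rw [← h, val_add]
  rcases lt_or_ge (x.val + y.val) n with h | h
  · left; rw [Nat.mod_eq_of_lt h]
  · right; rw [Nat.mod_eq_sub_mod h, Nat.mod_eq_of_lt (by omega)]; omega

/-- If `a + b = 1` with `a`, `b` coprime to `n`, the number of `x` in the lower half with `a x` in
the upper half and `b x` in the lower half has the parity given by the sign of `2 a`. -/
theorem prod_lowerHalf_ite (hn : Odd n) {a b : ℤ} (hab : a + b = 1) (ha : IsCoprime a n)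
    (hb : IsCoprime b n) :
    ∏ x ∈ lowerHalf n, (if n < 2 * (a • x).val ∧ 2 * (b • x).val < n then (-1 : ℤ) else 1)
      = jacobiSym (2 * a) n := by
  have h2 : IsCoprime (2 : ℤ) n := by
    obtain ⟨m, rfl⟩ := hn
    exact ⟨-m, 1, by push_cast; ring⟩
  have hH := isHalfSystem_lowerHalf hn
  have ne {u : ℤ} (hu : IsCoprime u n) (x : ZMod n) (hx : x ≠ 0) : u • x ≠ 0 :=
    fun h => hx ((bijective_zsmul hu).1 (by simpa using h))
  have hsum (x : ZMod n) : a • x + b • x = x := by rw [← add_zsmul, hab, one_zsmul]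
  have hneg (x : ZMod n) (hx : x ≠ 0) := val_neg_add_val hx
  let t : ZMod n → ℤ := fun x => if (a • x).val + (b • x).val = x.val then 1 else -1
  have ht : ∀ x, x ≠ 0 → t (-x) = -t x := by
    intro x hx
    have e1 := hneg x hx
    have e2 := hneg _ (ne ha x hx)
    have e3 := hneg _ (ne hb x hx)
    have e4 := val_eq_or_of_add_eq (hsum x)
    have e5 := x.val_lt
    simp only [t, smul_neg]
    split_ifs <;> omega
  have hdouble : ∏ x ∈ lowerHalf n, t ((2 : ℤ) • x)
      = gaussSign (lowerHalf n) a * gaussSign (lowerHalf n) b := by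
    rw [gaussSign, gaussSign, ← Finset.prod_mul_distrib]
    refine Finset.prod_congr rfl fun x hx => ?_
    obtain ⟨hx0, hx⟩ := mem_lowerHalf.1 hx
    rw [halfSign_lowerHalf (ne ha x hx0), halfSign_lowerHalf (ne hb x hx0)]
    have e4 := val_eq_or_of_add_eq (hsum x)
    have d1 := val_eq_or_of_add_eq (two_zsmul x).symm
    have d2 := val_eq_or_of_add_eq (two_zsmul (a • x)).symm
    have d3 := val_eq_or_of_add_eq (two_zsmul (b • x)).symm
    have l1 := (a • x).val_lt
    have l2 := (b • x).val_lt
    have l3 := ((2 : ℤ) • a • x).val_lt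
    have l4 := ((2 : ℤ) • b • x).val_lt
    have l5 := ((2 : ℤ) • x).val_lt
    simp only [t, smul_comm _ (2 : ℤ) x]
    split_ifs <;> omega
  have hprod : ∏ x ∈ lowerHalf n,
      (if n < 2 * (a • x).val ∧ 2 * (b • x).val < n then (-1 : ℤ) else 1)
      = gaussSign (lowerHalf n) b * ∏ x ∈ lowerHalf n, t x := by
    rw [gaussSign, ← Finset.prod_mul_distrib]
    refine Finset.prod_congr rfl fun x hx => ?_
    obtain ⟨hx0, hx⟩ := mem_lowerHalf.1 hx
    rw [halfSign_lowerHalf (ne hb x hx0)]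
    have e4 := val_eq_or_of_add_eq (hsum x)
    have l1 := (a • x).val_lt
    have l2 := (b • x).val_lt
    obtain ⟨m, hm⟩ := hn
    simp only [t]
    split_ifs <;> omega
  have sq {u : ℤ} (hu : IsCoprime u n) : jacobiSym u n ^ 2 = 1 :=
    jacobiSym.sq_one (Int.isCoprime_iff_gcd_eq_one.1 hu)
  rw [hH.prod_zsmul (bijective_zsmul h2) ht] at hdouble
  rw [hprod, jacobiSym.mul_left]
  rw [gaussSign_eq_jacobiSym n hn ha, gaussSign_eq_jacobiSym n hn hb,
    gaussSign_eq_jacobiSym n hn h2] at *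
  linear_combination jacobiSym b n * jacobiSym 2 n * hdouble
    - jacobiSym b n * (∏ x ∈ lowerHalf n, t x) * sq h2
    + jacobiSym 2 n * jacobiSym a n * sq hb

end ZMod

/-- Theorem 1.1, (1.6): for a positive odd integer `n` and an integer `x` with
`gcd(x(1-x), n) = 1`, we have
`(-1)^{#{1 ≤ k < n/2 : {kx}_n > n/2 and {k(1-x)}_n < n/2}} = ((2x)/n)` (Jacobi symbol). -/
theorem statement3 (n : ℕ) (hn : Odd n) (hn0 : 0 < n) (x : ℤ)
    (hx : Int.gcd (x * (1 - x)) n = 1) :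
    (-1 : ℤ) ^ ((Finset.Ico 1 n).filter
        (fun k => 2 * k < n ∧ (n : ℤ) < 2 * (((k : ℤ) * x) % (n : ℤ))
          ∧ 2 * (((k : ℤ) * (1 - x)) % (n : ℤ)) < (n : ℤ))).card
      = jacobiSym (2 * x) n := by
  have : NeZero n := ⟨hn0.ne'⟩
  have hcop : IsCoprime (x * (1 - x)) (n : ℤ) := Int.isCoprime_iff_gcd_eq_one.2 hx
  rw [← ZMod.prod_lowerHalf_ite hn (add_sub_cancel x 1) hcop.of_mul_left_left
    hcop.of_mul_left_right, ZMod.prod_lowerHalf, ← Finset.filter_filter, Finset.prod_ite,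
    Finset.prod_const, Finset.prod_const_one, mul_one]
  have hval (u : ℤ) (k : ℕ) : ((k : ℤ) * u) % (n : ℤ) = ((u • (k : ZMod n)).val : ℤ) := by
    rw [← ZMod.val_intCast, zsmul_eq_mul, mul_comm]
    push_cast
    rfl
  simp only [hval]
  congr 3
  ext k
  norm_cast
end

section
/- Let p be an odd prime and let a, b, c be integers with p ∤ ac(a+b+c), and set Δ = b² − 4ac. If p | Δ then S_p(a,b,c) ≡ ((a(a+b+c))/p) (mod p), and if p ∤ Δ then S_p(a,b,c) ≡ −((ac(a+b+c)Δ)/p) (mod p). -/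
section Auxiliary

open Finset

variable {p : ℕ} [Fact p.Prime]

/-- A product over pairs `1 ≤ i < j ≤ p - 1`, regrouped by the ratio `i / j` in `ZMod p`. -/
theorem prod_Ico_prod_Ico_eq_prod_ratio {M : Type*} [CommMonoid M] (G : ZMod p → ZMod p → M) :
    ∏ j ∈ Ico 1 p, ∏ i ∈ Ico 1 j, G i j =
      ∏ t ∈ (univ.erase (0 : ZMod p)).erase 1,
        ∏ j ∈ (univ.erase (0 : ZMod p)).filter (fun j => (t * j).val < j.val), G (t * j) j := by
  have hcast {n : ℕ} (h1 : 1 ≤ n) (h2 : n < p) : (n : ZMod p) ≠ 0 := fun h0 =>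
    absurd (Nat.le_of_dvd h1 ((ZMod.natCast_eq_zero_iff n p).1 h0)) (by omega)
  have hpos {x : ZMod p} (hx : x ≠ 0) : 1 ≤ x.val := by
    have := (ZMod.val_ne_zero x).2 hx
    omega
  rw [prod_sigma', prod_sigma']
  refine prod_bij' (fun x _ => ⟨(x.2 : ZMod p) / (x.1 : ZMod p), (x.1 : ZMod p)⟩)
    (fun y _ => ⟨y.2.val, (y.1 * y.2).val⟩) ?_ ?_ ?_ ?_ ?_
  · rintro ⟨j, i⟩ hx
    simp only [mem_sigma, mem_Ico] at hx
    have hj := hcast hx.1.1 hx.1.2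
    have hi := hcast hx.2.1 (hx.2.2.trans hx.1.2)
    have hne : (i : ZMod p) ≠ j := fun h => by
      have := congrArg ZMod.val h
      rw [ZMod.val_cast_of_lt hx.1.2, ZMod.val_cast_of_lt (hx.2.2.trans hx.1.2)] at this
      omega
    simp only [mem_sigma, mem_erase, mem_filter, mem_univ, and_true]
    refine ⟨⟨fun h => hne ((div_eq_one_iff_eq hj).1 h), div_ne_zero hi hj⟩, hj, ?_⟩
    rw [div_mul_cancel₀ _ hj, ZMod.val_cast_of_lt hx.1.2,
      ZMod.val_cast_of_lt (hx.2.2.trans hx.1.2)]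
    exact hx.2.2
  · rintro ⟨t, j⟩ hy
    simp only [mem_sigma, mem_erase, mem_filter, mem_univ, and_true] at hy
    simp only [mem_sigma, mem_Ico]
    exact ⟨⟨hpos hy.2.1, j.val_lt⟩, hpos (mul_ne_zero hy.1.2 hy.2.1), hy.2.2⟩
  · rintro ⟨j, i⟩ hx
    simp only [mem_sigma, mem_Ico] at hx
    have hj := hcast hx.1.1 hx.1.2
    simp only [div_mul_cancel₀ _ hj, ZMod.val_cast_of_lt hx.1.2,
      ZMod.val_cast_of_lt (hx.2.2.trans hx.1.2)]
  · rintro ⟨t, j⟩ hy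
    simp only [mem_sigma, mem_erase, mem_filter, mem_univ, and_true] at hy
    simp [mul_div_cancel_right₀ _ hy.2.1]
  · rintro ⟨j, i⟩ hx
    simp only [mem_sigma, mem_Ico] at hx
    simp only [div_mul_cancel₀ _ (hcast hx.1.1 hx.1.2)]

/-- If `P` selects exactly one of `j`, `-j` for every nonzero `j`, then the product of `j ^ 2 * q`
over the selected nonzero `j` is `-(-q) ^ (p / 2)`. -/
theorem prod_sq_mul_of_half_system (hp : p ≠ 2) (P : ZMod p → Prop) [DecidablePred P]
    (hP : ∀ j, j ≠ 0 → (P (-j) ↔ ¬ P j)) (q : ZMod p) :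
    ∏ j ∈ (univ.erase (0 : ZMod p)).filter P, j ^ 2 * q = -(-q) ^ (p / 2) := by
  set s := univ.erase (0 : ZMod p)
  have hcompl : s.filter (fun j => ¬ P j) = (s.filter P).image (fun j => -j) := by
    ext j
    simp only [s, mem_filter, mem_erase, mem_univ, and_true, mem_image]
    constructor
    · rintro ⟨hj, hn⟩
      exact ⟨-j, ⟨neg_ne_zero.2 hj, (hP j hj).2 hn⟩, neg_neg j⟩
    · rintro ⟨k, ⟨hk, hPk⟩, rfl⟩
      exact ⟨neg_ne_zero.2 hk, fun h => (hP k hk).1 h hPk⟩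
  have hcard : (s.filter P).card = p / 2 := by
    have h1 := card_filter_add_card_filter_not (s := s) P
    rw [hcompl, card_image_of_injective _ neg_injective, card_erase_of_mem (mem_univ _),
      card_univ, ZMod.card] at h1
    have := (Fact.out : p.Prime).eq_two_or_odd.resolve_left hp
    omega
  have hprod : ∏ j ∈ s, j = -1 := by
    have := FiniteField.prod_univ_units_id_eq_neg_one (K := ZMod p)
    have h2 := congrArg Units.val this
    rw [Units.coe_prod] at h2
    rw [Units.val_neg, Units.val_one] at h2
    rw [← h2]
    symm
    refine prod_bij' (fun (u : (ZMod p)ˣ) _ => (u : ZMod p))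
      (fun j hj => Units.mk0 j (ne_of_mem_erase hj)) ?_ ?_ ?_ ?_ ?_ <;> simp [s]
  rw [← prod_filter_mul_prod_filter_not s P, hcompl,
    prod_image neg_injective.injOn, ← prod_mul_distrib] at hprod
  rw [← hcard, ← prod_const, neg_eq_neg_one_mul, ← hprod, ← prod_mul_distrib]
  exact prod_congr rfl fun j _ => by ring

theorem val_mul_neg_lt_val_neg_iff {t j : ZMod p} (ht0 : t ≠ 0) (ht1 : t ≠ 1) (hj : j ≠ 0) :
    (t * -j).val < (-j).val ↔ ¬ (t * j).val < j.val := by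
  have hne : (t * j).val ≠ j.val := fun h =>
    ht1 (mul_right_cancel₀ hj (by rw [ZMod.val_injective p h, one_mul]))
  have h1 := (t * j).val_lt
  have h2 := j.val_lt
  rw [mul_neg, ZMod.neg_val, ZMod.neg_val, if_neg hj, if_neg (mul_ne_zero ht0 hj)]
  omega

theorem pow_half_sq (hp : p ≠ 2) {x : ZMod p} (hx : x ≠ 0) : (x ^ (p / 2)) ^ 2 = 1 := by
  have := (Fact.out : p.Prime).eq_two_or_odd
  rw [← pow_mul, show p / 2 * 2 = p - 1 by omega]
  exact ZMod.pow_card_sub_one_eq_one hx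

/-- The contribution of the direction `i / j = t` to the product of the nonzero values of a binary
quadratic form taking the value `q` at `(t, 1)`. -/
def directionFactor (q : ZMod p) : ZMod p := if q = 0 then 1 else -(-q) ^ (p / 2)

theorem directionFactor_mul_self (hp : p ≠ 2) (q : ZMod p) :
    directionFactor q * directionFactor q = 1 := by
  unfold directionFactor
  split_ifs with h
  · exact one_mul 1
  · rw [neg_mul_neg, ← sq, pow_half_sq hp (neg_ne_zero.2 h)]

theorem prod_Ico_prod_Ico_quadratic (hp : p ≠ 2) (a b c : ZMod p) :
    (∏ j ∈ Ico 1 p, ∏ i ∈ Ico 1 j,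
      if a * (i : ZMod p) ^ 2 + b * i * j + c * (j : ZMod p) ^ 2 = 0 then 1
      else a * (i : ZMod p) ^ 2 + b * i * j + c * (j : ZMod p) ^ 2) =
      ∏ t ∈ (univ.erase (0 : ZMod p)).erase 1, directionFactor (a * t ^ 2 + b * t + c) := by
  rw [prod_Ico_prod_Ico_eq_prod_ratio (fun i j : ZMod p =>
    if a * i ^ 2 + b * i * j + c * j ^ 2 = 0 then 1 else a * i ^ 2 + b * i * j + c * j ^ 2)]
  refine prod_congr rfl fun t ht => ?_
  simp only [mem_erase, mem_univ, and_true] at ht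
  have hval (j : ZMod p) : a * (t * j) ^ 2 + b * (t * j) * j + c * j ^ 2 =
    j ^ 2 * (a * t ^ 2 + b * t + c) := by ring
  unfold directionFactor
  split_ifs with hq
  · exact prod_eq_one fun j _ => by rw [hval, hq, mul_zero, if_pos rfl]
  · rw [← prod_sq_mul_of_half_system hp (fun j => (t * j).val < j.val)
      (fun j hj => val_mul_neg_lt_val_neg_iff ht.2 ht.1 hj)]
    refine prod_congr rfl fun j hj => ?_
    rw [hval, if_neg]
    exact mul_ne_zero (pow_ne_zero 2 (ne_of_mem_erase (mem_filter.1 hj).1)) hq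

/-- The reflection `t ↦ -b / a - t` pairs off all directions but the vertex of the parabola. -/
theorem prod_directionFactor (hp : p ≠ 2) {a : ZMod p} (ha : a ≠ 0) (b c : ZMod p) :
    ∏ t, directionFactor (a * t ^ 2 + b * t + c) =
      directionFactor (-(b ^ 2 - 4 * a * c) / (4 * a)) := by
  have h2 : (2 : ZMod p) ≠ 0 := Ring.two_ne_zero (by rwa [ZMod.ringChar_zmod_n])
  have h4 : (4 : ZMod p) ≠ 0 := by
    rw [show (4 : ZMod p) = 2 * 2 by norm_num]
    exact mul_ne_zero h2 h2
  rw [← mul_prod_erase univ _ (mem_univ (-b / (2 * a))), prod_involution (fun t _ => -b / a - t)]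
  · rw [mul_one]
    congr 1
    field_simp
    ring
  · intro t _
    have : a * (-b / a - t) ^ 2 + b * (-b / a - t) + c = a * t ^ 2 + b * t + c := by
      field_simp
      ring
    rw [this, directionFactor_mul_self hp]
  · intro t ht _ hfix
    apply ne_of_mem_erase ht
    rw [eq_div_iff (mul_ne_zero h2 ha)]
    field_simp at hfix
    linear_combination -hfix
  · intro t ht
    refine mem_erase.2 ⟨fun h => ne_of_mem_erase ht ?_, mem_univ _⟩
    field_simp at h ⊢
    linear_combination -h
  · intro t _
    ring

theorem prod_erase_directionFactor (hp : p ≠ 2) {a : ZMod p} (ha : a ≠ 0) (b c : ZMod p) :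
    ∏ t ∈ (univ.erase (0 : ZMod p)).erase 1, directionFactor (a * t ^ 2 + b * t + c) =
      directionFactor (-(b ^ 2 - 4 * a * c) / (4 * a)) * directionFactor c *
        directionFactor (a + b + c) := by
  rw [← prod_directionFactor hp ha, ← mul_prod_erase univ _ (mem_univ (0 : ZMod p)),
    ← mul_prod_erase (univ.erase 0) _ (mem_erase.2 ⟨one_ne_zero, mem_univ (1 : ZMod p)⟩)]
  have hc := directionFactor_mul_self hp c
  have hs := directionFactor_mul_self hp (a + b + c)
  have e0 : a * (0 : ZMod p) ^ 2 + b * 0 + c = c := by ring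
  have e1 : a * (1 : ZMod p) ^ 2 + b * 1 + c = a + b + c := by ring
  rw [e0, e1]
  generalize ∏ t ∈ (univ.erase (0 : ZMod p)).erase 1, directionFactor (a * t ^ 2 + b * t + c) = X
  linear_combination (-X * directionFactor (a + b + c) ^ 2) * hc - X * hs

end Auxiliary


/-- Theorem 1.2, (1.8): for an odd prime `p` and integers `a, b, c` with
`p ∤ ac(a+b+c)`, letting `Δ = b² - 4ac` and
`S_p(a,b,c) = ∏_{1 ≤ i < j ≤ p-1, p ∤ ai²+bij+cj²} (ai² + bij + cj²)`,
we have `S_p(a,b,c) ≡ ((a(a+b+c))/p) (mod p)` if `p ∣ Δ`, and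
`S_p(a,b,c) ≡ -((ac(a+b+c)Δ)/p) (mod p)` if `p ∤ Δ`. -/
theorem statement4 (p : ℕ) [Fact p.Prime] (hodd : Odd p) (a b c : ℤ)
    (h : ¬ (p : ℤ) ∣ a * c * (a + b + c)) :
    ((p : ℤ) ∣ b ^ 2 - 4 * a * c →
      (∏ j ∈ Finset.Ico 1 p, ∏ i ∈ Finset.Ico 1 j,
          if (p : ℤ) ∣ (a * (i : ℤ) ^ 2 + b * (i : ℤ) * (j : ℤ) + c * (j : ℤ) ^ 2) then 1
          else a * (i : ℤ) ^ 2 + b * (i : ℤ) * (j : ℤ) + c * (j : ℤ) ^ 2)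
        ≡ legendreSym p (a * (a + b + c)) [ZMOD (p : ℤ)]) ∧
    (¬ (p : ℤ) ∣ b ^ 2 - 4 * a * c →
      (∏ j ∈ Finset.Ico 1 p, ∏ i ∈ Finset.Ico 1 j,
          if (p : ℤ) ∣ (a * (i : ℤ) ^ 2 + b * (i : ℤ) * (j : ℤ) + c * (j : ℤ) ^ 2) then 1
          else a * (i : ℤ) ^ 2 + b * (i : ℤ) * (j : ℤ) + c * (j : ℤ) ^ 2)
        ≡ -legendreSym p (a * c * (a + b + c) * (b ^ 2 - 4 * a * c)) [ZMOD (p : ℤ)]) := by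
  have hp : p ≠ 2 := by
    rintro rfl
    exact absurd hodd (by decide)
  have h0 : (a : ZMod p) * c * (a + b + c) ≠ 0 := fun h0 =>
    h ((ZMod.intCast_zmod_eq_zero_iff_dvd _ p).1 (by push_cast; exact h0))
  have ha : (a : ZMod p) ≠ 0 := fun h => h0 (by rw [h]; ring)
  have hc : (c : ZMod p) ≠ 0 := fun h => h0 (by rw [h]; ring)
  have hs : (a + b + c : ZMod p) ≠ 0 := fun h => h0 (by rw [h]; ring)
  have h2 : (2 : ZMod p) ≠ 0 := Ring.two_ne_zero (by rwa [ZMod.ringChar_zmod_n])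
  have hneg := pow_half_sq hp (neg_ne_zero.2 (one_ne_zero (α := ZMod p)))
  have hprod : ((∏ j ∈ Finset.Ico 1 p, ∏ i ∈ Finset.Ico 1 j,
          if (p : ℤ) ∣ (a * (i : ℤ) ^ 2 + b * (i : ℤ) * (j : ℤ) + c * (j : ℤ) ^ 2) then 1
          else a * (i : ℤ) ^ 2 + b * (i : ℤ) * (j : ℤ) + c * (j : ℤ) ^ 2 : ℤ) : ZMod p) =
      directionFactor (-((b : ZMod p) ^ 2 - 4 * (a : ZMod p) * (c : ZMod p)) / (4 * (a : ZMod p))) *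
        directionFactor (c : ZMod p) * directionFactor (a + b + c : ZMod p) := by
    rw [← prod_erase_directionFactor hp ha, ← prod_Ico_prod_Ico_quadratic hp]
    simp only [← ZMod.intCast_zmod_eq_zero_iff_dvd]
    push_cast
    rfl
  have hcs : directionFactor (c : ZMod p) * directionFactor (a + b + c : ZMod p) =
      (c : ZMod p) ^ (p / 2) * (a + b + c : ZMod p) ^ (p / 2) := by
    unfold directionFactor
    rw [if_neg hc, if_neg hs, neg_pow (c : ZMod p), neg_pow (a + b + c : ZMod p)]
    linear_combination ((c : ZMod p) ^ (p / 2) * (a + b + c : ZMod p) ^ (p / 2)) * hneg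
  have ha2 := pow_half_sq hp ha
  constructor <;> intro hD <;> rw [← ZMod.intCast_zmod_eq_zero_iff_dvd] at hD <;>
    push_cast at hD <;> rw [← ZMod.intCast_eq_intCast_iff, hprod, mul_assoc, hcs]
  · have hac : (a : ZMod p) * c ≠ 0 := mul_ne_zero ha hc
    have hb : (b : ZMod p) ≠ 0 := by
      rintro hb
      rw [hb] at hD
      exact mul_ne_zero (pow_ne_zero 2 h2) hac (by linear_combination -hD)
    have key : (a : ZMod p) ^ (p / 2) * (c : ZMod p) ^ (p / 2) = 1 := by
      have e : (b : ZMod p) ^ 2 = 2 ^ 2 * (a * c) := by linear_combination hD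
      have e2 := congrArg (· ^ (p / 2)) e
      simp only [mul_pow, ← pow_mul, mul_comm 2 (p / 2)] at e2
      rw [pow_mul, pow_mul, pow_half_sq hp hb, pow_half_sq hp h2, one_mul] at e2
      exact e2.symm
    rw [hD, neg_zero, zero_div, directionFactor, if_pos rfl, one_mul, legendreSym.eq_pow]
    push_cast
    rw [mul_pow]
    linear_combination ((a + b + c : ZMod p) ^ (p / 2)) *
      ((a : ZMod p) ^ (p / 2) * key - (c : ZMod p) ^ (p / 2) * ha2)
  · have hq : -((b : ZMod p) ^ 2 - 4 * (a : ZMod p) * (c : ZMod p)) / (4 * (a : ZMod p)) ≠ 0 :=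
      div_ne_zero (neg_ne_zero.2 hD) (mul_ne_zero (by
        rw [show (4 : ZMod p) = 2 * 2 by norm_num]; exact mul_ne_zero h2 h2) ha)
    have e : -(-((b : ZMod p) ^ 2 - 4 * (a : ZMod p) * (c : ZMod p)) / (4 * (a : ZMod p))) =
        (a : ZMod p) * ((b : ZMod p) ^ 2 - 4 * (a : ZMod p) * (c : ZMod p)) *
          ((2 * (a : ZMod p))⁻¹) ^ 2 := by
      rw [show (4 : ZMod p) = 2 * 2 by norm_num]
      field_simp
    have hinv := pow_half_sq hp (inv_ne_zero (mul_ne_zero h2 ha))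
    rw [directionFactor, if_neg hq, e]
    push_cast
    rw [legendreSym.eq_pow]
    push_cast
    simp only [mul_pow _ _ (p / 2)]
    rw [pow_right_comm, hinv]
    ring
end

section
/- Let p be an odd prime and let a, b, c be integers with p ∤ ac(a−c) and p | a+b+c. Then S_p(a,b,c) ≡ ((−ac)/p) (mod p). -/
open Finset

/-- The product over `1 ≤ j < p` of a function of the residue of `j`. -/
lemma ZMod.prod_Ico_eq_prod_erase_zero {M : Type*} [CommMonoid M] (p : ℕ) [Fact p.Prime]
    (f : ℕ → M) :
    ∏ i ∈ Ico 1 p, f i = ∏ x ∈ (univ : Finset (ZMod p)).erase 0, f x.val := by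
  refine prod_bij' (fun i _ => (i : ZMod p)) (fun x _ => x.val) ?_ ?_ ?_ ?_ ?_
  · intro i hi
    rw [mem_Ico] at hi
    simp only [mem_erase, mem_univ, and_true, ne_eq, ZMod.natCast_eq_zero_iff]
    exact Nat.not_dvd_of_pos_of_lt (by omega) (by omega)
  · intro x hx
    have := (ZMod.val_ne_zero x).2 (ne_of_mem_erase hx)
    have := ZMod.val_lt x
    rw [mem_Ico]; omega
  · intro i hi
    exact ZMod.val_natCast_of_lt (mem_Ico.1 hi).2
  · intro x _
    exact ZMod.natCast_zmod_val x
  · intro i hi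
    rw [ZMod.val_natCast_of_lt (mem_Ico.1 hi).2]

/-- Wilson's theorem, as a product over the nonzero residues. -/
lemma ZMod.prod_erase_zero_eq_neg_one (p : ℕ) [Fact p.Prime] :
    ∏ x ∈ (univ : Finset (ZMod p)).erase 0, x = -1 := by
  rw [← ZMod.prod_Ico_one_prime p, ZMod.prod_Ico_eq_prod_erase_zero p]
  simp only [ZMod.natCast_zmod_val]

/-- A product over a half system of residues modulo `p`. -/
lemma ZMod.prod_filter_mul_sq (p : ℕ) [Fact p.Prime] (hodd : Odd p) (A : ZMod p → Prop)
    [DecidablePred A] (hA : ∀ x, x ≠ 0 → (A (-x) ↔ ¬ A x)) (u : ZMod p) :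
    ∏ x ∈ ((univ : Finset (ZMod p)).erase 0).filter A, u * x ^ 2 = -(-u) ^ (p / 2) := by
  set s := (univ : Finset (ZMod p)).erase 0 with hs
  have hneg : ∀ f : ZMod p → ZMod p,
      ∏ x ∈ s.filter A, f (-x) = ∏ x ∈ s.filter (fun x => ¬ A x), f x := by
    intro f
    refine prod_bij' (fun x _ => -x) (fun x _ => -x) ?_ ?_ ?_ ?_ ?_ <;>
      simp +contextual [hs, hA]
  have hcard' : #(s.filter A) = #(s.filter (fun x => ¬ A x)) := by
    refine card_bij' (fun x _ => -x) (fun x _ => -x) ?_ ?_ ?_ ?_ <;>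
      simp +contextual [hs, hA]
  have hsum := card_filter_add_card_filter_not (s := s) A
  have hscard : #s = p - 1 := by
    rw [hs, card_erase_of_mem (mem_univ _), card_univ, ZMod.card]
  have hcard : #(s.filter A) = p / 2 := by
    obtain ⟨k, rfl⟩ := hodd
    omega
  calc ∏ x ∈ s.filter A, u * x ^ 2
      = ∏ x ∈ s.filter A, (-u) * (x * -x) := prod_congr rfl fun x _ => by ring
    _ = (-u) ^ (p / 2) * ((∏ x ∈ s.filter A, x) * ∏ x ∈ s.filter (fun x => ¬ A x), x) := by
        rw [prod_mul_distrib, prod_const, hcard, prod_mul_distrib, hneg fun x => x]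
    _ = -(-u) ^ (p / 2) := by
        rw [prod_filter_mul_prod_filter_not, ZMod.prod_erase_zero_eq_neg_one]; ring

lemma ZMod.val_mul_neg_lt_iff (p : ℕ) [Fact p.Prime] {r x : ZMod p} (hr : r ≠ 0) (hr1 : r ≠ 1)
    (hx : x ≠ 0) : (r * -x).val < (-x).val ↔ ¬ (r * x).val < x.val := by
  have : NeZero x := ⟨hx⟩
  have : NeZero (r * x) := ⟨mul_ne_zero hr hx⟩
  rw [mul_neg, ZMod.val_neg_of_ne_zero, ZMod.val_neg_of_ne_zero]
  have h1 := ZMod.val_lt x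
  have h2 := ZMod.val_lt (r * x)
  have h3 : (r * x).val ≠ x.val := by
    intro h
    exact hr1 (mul_right_cancel₀ hx ((ZMod.val_injective p h).trans (one_mul x).symm))
  omega

/-- The product of the nonzero values of a nonconstant affine function modulo `p`. -/
lemma ZMod.prod_erase_affine (p : ℕ) [Fact p.Prime] {a c t : ZMod p} (ha : a ≠ 0)
    (ht : a * t = c) : ∏ r ∈ (univ : Finset (ZMod p)).erase t, (a * r - c) = -1 := by
  rw [← ZMod.prod_erase_zero_eq_neg_one p]
  subst ht
  refine prod_bij' (fun r _ => a * r - a * t) (fun x _ => x / a + t) ?_ ?_ ?_ ?_ ?_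
  · intro r hr
    simpa [sub_eq_zero, ha] using hr
  · intro x hx
    simpa [ha] using hx
  · intro r _
    field_simp; ring
  · intro x _
    field_simp; ring
  · intros; rfl

/-- The product of the values `(r - 1) * (a * r - c)` over the residues `r ≠ 0, 1, c / a`. -/
lemma ZMod.prod_erase_mul_sq_eq (p : ℕ) [Fact p.Prime] {a c t : ZMod p} (ha : a ≠ 0)
    (hc : c ≠ 0) (hac : a ≠ c) (ht : a * t = c) :
    (∏ r ∈ (((univ : Finset (ZMod p)).erase 0).erase 1).erase t, (r - 1) * (a * r - c))
      * (c * (a - c)) ^ 2 = -(a * c) := by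
  have ht0 : t ≠ 0 := by rintro rfl; simp at ht; exact hc ht.symm
  have ht1 : t ≠ 1 := by rintro rfl; simp at ht; exact hac ht
  have hP : (t - 1) * (-1 * ∏ r ∈ (((univ : Finset (ZMod p)).erase 0).erase 1).erase t, (r - 1))
      = -1 := by
    have h := ZMod.prod_erase_affine p (a := 1) (c := 1) (t := 1) one_ne_zero (one_mul 1)
    rw [← mul_prod_erase _ _ (a := 0) (by simp), ← mul_prod_erase _ _ (a := t) (by simp [*]),
      erase_right_comm (a := 1) (b := 0)] at h
    simp only [one_mul, zero_sub] at h
    linear_combination h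
  have hQ : -c * ((a - c) *
      ∏ r ∈ (((univ : Finset (ZMod p)).erase 0).erase 1).erase t, (a * r - c)) = -1 := by
    have h := ZMod.prod_erase_affine p ha ht
    rw [← mul_prod_erase _ _ (a := 0) (by simp [ht0.symm]),
      ← mul_prod_erase _ _ (a := 1) (by simp [ht1.symm]),
      erase_right_comm (a := t) (b := 0), erase_right_comm (a := t) (b := 1)] at h
    simpa using h
  rw [prod_mul_distrib]
  set P := ∏ r ∈ (((univ : Finset (ZMod p)).erase 0).erase 1).erase t, (r - 1)
  set Q := ∏ r ∈ (((univ : Finset (ZMod p)).erase 0).erase 1).erase t, (a * r - c)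
  have hP' : P * (c - a) = a := by
    linear_combination (-a) * hP - P * ht
  have hQ' : Q * (c * (a - c)) = 1 := by linear_combination -hQ
  calc P * Q * (c * (a - c)) ^ 2 = -c * (P * (c - a)) * (Q * (c * (a - c))) := by ring
    _ = -(a * c) := by rw [hP', hQ']; ring

theorem statement5 (p : ℕ) [Fact p.Prime] (hodd : Odd p) (a b c : ℤ)
    (h1 : ¬ (p : ℤ) ∣ a * c * (a - c)) (h2 : (p : ℤ) ∣ a + b + c) :
    (∏ j ∈ Finset.Ico 1 p, ∏ i ∈ Finset.Ico 1 j,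
        if (p : ℤ) ∣ (a * (i : ℤ) ^ 2 + b * (i : ℤ) * (j : ℤ) + c * (j : ℤ) ^ 2) then 1
        else a * (i : ℤ) ^ 2 + b * (i : ℤ) * (j : ℤ) + c * (j : ℤ) ^ 2)
      ≡ legendreSym p (-(a * c)) [ZMOD (p : ℤ)] := by
  rw [← ZMod.intCast_eq_intCast_iff, legendreSym.eq_pow]
  rw [← ZMod.intCast_zmod_eq_zero_iff_dvd] at h1 h2
  simp only [← ZMod.intCast_zmod_eq_zero_iff_dvd]
  push_cast at h1 h2 ⊢
  generalize (a : ZMod p) = a at *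
  generalize (b : ZMod p) = b at *
  generalize (c : ZMod p) = c at *
  obtain rfl : b = -a - c := by linear_combination h2
  obtain ⟨⟨ha, hc⟩, hac⟩ : (a ≠ 0 ∧ c ≠ 0) ∧ a ≠ c := by
    simpa [sub_eq_zero] using h1
  set s := (univ : Finset (ZMod p)).erase 0 with hs
  obtain ⟨t, ht⟩ : ∃ t, a * t = c := ⟨c / a, by field_simp⟩
  have ht0 : t ≠ 0 := by rintro rfl; simp at ht; exact hc ht.symm
  have ht1 : t ≠ 1 := by rintro rfl; simp at ht; exact hac ht
  set G : ZMod p → ZMod p → ZMod p := fun i j =>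
    if a * i ^ 2 + (-a - c) * i * j + c * j ^ 2 = 0 then 1
    else a * i ^ 2 + (-a - c) * i * j + c * j ^ 2 with hG
  have hGmul : ∀ r x, G (r * x) x = if (r - 1) * (a * r - c) * x ^ 2 = 0 then 1
      else (r - 1) * (a * r - c) * x ^ 2 := by
    intro r x
    have : a * (r * x) ^ 2 + (-a - c) * (r * x) * x + c * x ^ 2
      = (r - 1) * (a * r - c) * x ^ 2 := by ring
    simp only [hG, this]
  have hrow : ∀ r ∈ s, (∏ x ∈ s, if (r * x).val < x.val then G (r * x) x else 1)
      = if r ∈ (s.erase 1).erase t then -(-((r - 1) * (a * r - c))) ^ (p / 2) else 1 := by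
    intro r hr
    have hr0 := ne_of_mem_erase hr
    split_ifs with hmem
    · simp only [mem_erase] at hmem
      have hu : (r - 1) * (a * r - c) ≠ 0 := by
        refine mul_ne_zero (sub_ne_zero.2 hmem.2.1) fun h => hmem.1 ?_
        exact mul_left_cancel₀ ha (by linear_combination h - ht)
      rw [← prod_filter, ← ZMod.prod_filter_mul_sq p hodd (fun x => (r * x).val < x.val)
        (fun x hx => ZMod.val_mul_neg_lt_iff p hr0 hmem.2.1 hx)]
      refine prod_congr rfl fun x hx => ?_
      have hx0 := ne_of_mem_erase (mem_filter.1 hx).1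
      rw [hGmul, if_neg (mul_ne_zero hu (pow_ne_zero 2 hx0))]
    · have hu : (r - 1) * (a * r - c) = 0 := by
        by_cases h : r = t
        · rw [h, ht]; ring
        · have : r = 1 := by simpa [h, hr] using hmem
          rw [this]; ring
      refine prod_eq_one fun x _ => ?_
      rw [hGmul, hu]; simp
  have hcard : Even #((s.erase 1).erase t) := by
    rw [card_erase_of_mem (by simp [hs, ht0, ht1]), card_erase_of_mem (by simp [hs]), hs,
      card_erase_of_mem (mem_univ _), card_univ, ZMod.card]
    obtain ⟨k, rfl⟩ := hodd
    exact ⟨k - 1, by omega⟩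
  have hone : ((c * (a - c)) ^ 2) ^ (p / 2) = 1 := by
    rw [← pow_mul, (by grind : 2 * (p / 2) = p - 1)]
    exact ZMod.pow_card_sub_one_eq_one (mul_ne_zero hc (sub_ne_zero.2 hac))
  calc ∏ j ∈ Ico 1 p, ∏ i ∈ Ico 1 j, G i j
      = ∏ j ∈ Ico 1 p, ∏ i ∈ Ico 1 p, if i < j then G i j else 1 := by
        refine prod_congr rfl fun j hj => ?_
        rw [← prod_filter]
        refine prod_congr ?_ fun _ _ => rfl
        ext i
        simp only [mem_Ico, mem_filter] at hj ⊢
        omega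
    _ = ∏ x ∈ s, ∏ y ∈ s, if y.val < x.val then G y x else 1 := by
        simp only [ZMod.prod_Ico_eq_prod_erase_zero p, ZMod.natCast_zmod_val, ← hs]
    _ = ∏ x ∈ s, ∏ r ∈ s, if (r * x).val < x.val then G (r * x) x else 1 := by
        refine prod_congr rfl fun x hx => ?_
        have hx0 := ne_of_mem_erase hx
        refine prod_bij' (fun y _ => y / x) (fun r _ => r * x) ?_ ?_ ?_ ?_ ?_ <;>
          simp +contextual [hs, hx0]
    _ = ∏ r ∈ s, if r ∈ (s.erase 1).erase t
          then -(-((r - 1) * (a * r - c))) ^ (p / 2) else 1 := by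
        rw [prod_comm]
        exact prod_congr rfl hrow
    _ = ∏ r ∈ (s.erase 1).erase t, -(-((r - 1) * (a * r - c))) ^ (p / 2) := by
        rw [← prod_filter]
        refine prod_congr ?_ fun _ _ => rfl
        ext r
        simp only [mem_filter, mem_erase]
        tauto
    _ = (∏ r ∈ (s.erase 1).erase t, (r - 1) * (a * r - c)) ^ (p / 2) := by
        rw [prod_neg, hcard.neg_one_pow, one_mul, prod_pow, prod_neg, hcard.neg_one_pow, one_mul]
    _ = (-(a * c)) ^ (p / 2) := by
        rw [← ZMod.prod_erase_mul_sq_eq p ha hc hac ht, mul_pow, hone, mul_one]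
end

section
/- Let p be an odd prime and let a, b, c be integers with p | a and p ∤ bc(b+c). Then S_p(a,b,c) ≡ ((−c(b+c))/p) (mod p). -/
/-- Multiplication by `t ≠ 0, 1` decreases the least residue of exactly one of `y` and `-y`. -/
theorem ZMod.val_mul_neg_lt_iff_s7 {p : ℕ} [Fact p.Prime] {t : ZMod p} (h0 : t ≠ 0) (h1 : t ≠ 1)
    (y : (ZMod p)ˣ) :
    (t * ((-y : (ZMod p)ˣ) : ZMod p)).val < ((-y : (ZMod p)ˣ) : ZMod p).val ↔
      ¬ (t * (y : ZMod p)).val < (y : ZMod p).val := by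
  have hy : (y : ZMod p) ≠ 0 := y.ne_zero
  have hty : t * (y : ZMod p) ≠ 0 := mul_ne_zero h0 hy
  have hne : (t * (y : ZMod p)).val ≠ (y : ZMod p).val := fun h =>
    h1 (mul_right_cancel₀ hy ((ZMod.val_injective p h).trans (one_mul _).symm))
  have hlt := ZMod.val_lt (y : ZMod p)
  have hlt' := ZMod.val_lt (t * (y : ZMod p))
  rw [Units.val_neg, mul_neg, ZMod.neg_val, ZMod.neg_val, if_neg hy, if_neg hty]
  omega

/-- A set of units of `ZMod p` containing exactly one of `y` and `-y` for each `y` has `p / 2`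
elements, and the product of their squares is determined by Wilson's theorem. -/
theorem ZMod.prod_sq_mul_of_half_system {p : ℕ} [Fact p.Prime] (hodd : Odd p)
    (H : Finset (ZMod p)ˣ) (hH : ∀ y, -y ∈ H ↔ y ∉ H) (u : ZMod p) :
    ∏ y ∈ H, ((y : ZMod p) ^ 2 * u) = -(-1) ^ (p / 2) * u ^ (p / 2) := by
  classical
  have hcompl : Hᶜ = H.image (fun y => -y) := by
    ext y
    simp only [Finset.mem_compl, Finset.mem_image]
    refine ⟨fun h => ⟨-y, (hH y).2 h, neg_neg y⟩, ?_⟩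
    rintro ⟨z, hz, rfl⟩ h
    exact (hH z).1 h hz
  have hinj : Set.InjOn (fun y : (ZMod p)ˣ => -y) H := neg_injective.injOn
  have hcard : H.card = p / 2 := by
    have h := H.card_add_card_compl
    rw [hcompl, Finset.card_image_of_injOn hinj, ZMod.card_units_eq_totient,
      Nat.totient_prime Fact.out] at h
    obtain ⟨k, rfl⟩ := hodd
    omega
  have hprod : ∏ y ∈ H, ((y : ZMod p) * -(y : ZMod p)) = -1 := by
    have h := Finset.prod_mul_prod_compl H (fun y : (ZMod p)ˣ => (y : ZMod p))
    rw [hcompl, Finset.prod_image hinj, ← Finset.prod_mul_distrib] at h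
    simp only [Units.val_neg] at h
    rw [h, ← Units.coe_prod, FiniteField.prod_univ_units_id_eq_neg_one]
    simp
  calc ∏ y ∈ H, ((y : ZMod p) ^ 2 * u)
      = ∏ y ∈ H, (((y : ZMod p) * -(y : ZMod p)) * (-1 * u)) :=
        Finset.prod_congr rfl fun y _ => by ring
    _ = -(-1) ^ (p / 2) * u ^ (p / 2) := by
        rw [Finset.prod_mul_distrib, hprod, Finset.prod_const, hcard, mul_pow]
        ring

/-- A product over `1 ≤ i < j ≤ p - 1`, rewritten in terms of `j` and the ratio `i / j`. -/
theorem ZMod.prod_Ico_Ico_eq {p : ℕ} [Fact p.Prime] (f : ZMod p → ZMod p → ZMod p) :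
    ∏ j ∈ Finset.Ico 1 p, ∏ i ∈ Finset.Ico 1 j, f i j =
      ∏ t : ZMod p, ∏ y : (ZMod p)ˣ,
        if t ≠ 0 ∧ (t * (y : ZMod p)).val < (y : ZMod p).val then f (t * y) y else 1 := by
  rw [Finset.prod_comm]
  symm
  refine Finset.prod_bij (fun y _ => (y : ZMod p).val) ?_ ?_ ?_ ?_
  · intro y _
    have := (ZMod.val_eq_zero (y : ZMod p)).not.2 y.ne_zero
    have := ZMod.val_lt (y : ZMod p)
    exact Finset.mem_Ico.2 (by omega)
  · intro y _ z _ h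
    exact Units.ext (ZMod.val_injective p h)
  · intro j hj
    obtain ⟨hj1, hjp⟩ := Finset.mem_Ico.1 hj
    have hj0 : (j : ZMod p) ≠ 0 := by
      rw [Ne, ZMod.natCast_eq_zero_iff]
      exact Nat.not_dvd_of_pos_of_lt hj1 hjp
    exact ⟨Units.mk0 _ hj0, Finset.mem_univ _, by simp [ZMod.val_cast_of_lt hjp]⟩
  · intro y _
    rw [← Finset.prod_filter]
    refine Finset.prod_bij (fun t _ => (t * (y : ZMod p)).val) ?_ ?_ ?_ ?_
    · intro t ht
      obtain ⟨h0, hlt⟩ := (Finset.mem_filter.1 ht).2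
      have := (ZMod.val_eq_zero (t * (y : ZMod p))).not.2 (mul_ne_zero h0 y.ne_zero)
      exact Finset.mem_Ico.2 (by omega)
    · intro s _ t _ h
      exact mul_right_cancel₀ y.ne_zero (ZMod.val_injective p h)
    · intro i hi
      obtain ⟨hi1, hiy⟩ := Finset.mem_Ico.1 hi
      have hip : i < p := hiy.trans (ZMod.val_lt _)
      have hi0 : (i : ZMod p) ≠ 0 := by
        rw [Ne, ZMod.natCast_eq_zero_iff]
        exact Nat.not_dvd_of_pos_of_lt hi1 hip
      have hmul : (i : ZMod p) / (y : ZMod p) * (y : ZMod p) = i :=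
        div_mul_cancel₀ _ y.ne_zero
      refine ⟨i / y, ?_, ?_⟩
      · rw [Finset.mem_filter, hmul, ZMod.val_cast_of_lt hip]
        exact ⟨Finset.mem_univ _, div_ne_zero hi0 y.ne_zero, hiy⟩
      · rw [hmul, ZMod.val_cast_of_lt hip]
    · intro t _
      simp

/-- The product of the nonzero values of `j * (B * i + C * j)` over `1 ≤ i < j ≤ p - 1`. -/
theorem ZMod.prod_Ico_Ico_bilinear {p : ℕ} [Fact p.Prime] (hodd : Odd p) {B C : ZMod p}
    (hB : B ≠ 0) (hC : C ≠ 0) (hBC : B + C ≠ 0) :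
    (∏ j ∈ Finset.Ico 1 p, ∏ i ∈ Finset.Ico 1 j,
        if B * (i : ZMod p) * (j : ZMod p) + C * (j : ZMod p) ^ 2 = 0 then 1
        else B * (i : ZMod p) * (j : ZMod p) + C * (j : ZMod p) ^ 2) =
      (-(C * (B + C))) ^ (p / 2) := by
  classical
  set T : Finset (ZMod p) := ((Finset.univ.erase 0).erase C).erase (B + C) with hT
  have hmemC : C ∈ (Finset.univ : Finset (ZMod p)).erase 0 := by simp [hC]
  have hmemBC : B + C ∈ ((Finset.univ : Finset (ZMod p)).erase 0).erase C := by simp [hB, hBC]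
  have hcard : Even T.card := by
    rw [hT, Finset.card_erase_of_mem hmemBC, Finset.card_erase_of_mem hmemC,
      Finset.card_erase_of_mem (Finset.mem_univ _), Finset.card_univ, ZMod.card]
    obtain ⟨k, rfl⟩ := hodd
    exact ⟨k - 1, by omega⟩
  have hprod : (∏ u ∈ T, u) * -(C * (B + C)) = 1 := by
    have h1 := Finset.mul_prod_erase _ (fun u : ZMod p => u) hmemBC
    have h2 := Finset.mul_prod_erase _ (fun u : ZMod p => u) hmemC
    have h3 : ∏ u ∈ (Finset.univ : Finset (ZMod p)).erase 0, u = -1 := by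
      have h4 : ∏ y : (ZMod p)ˣ, (y : ZMod p) = -1 := by
        rw [← Units.coe_prod, FiniteField.prod_univ_units_id_eq_neg_one]
        simp
      rw [← h4]
      symm
      refine Finset.prod_bij (fun y _ => (y : ZMod p)) (by simp) ?_ ?_ (by simp)
      · intro y _ z _ h
        exact Units.ext h
      · intro u hu
        exact ⟨Units.mk0 u (Finset.mem_erase.1 hu).1, Finset.mem_univ _, rfl⟩
    rw [← h1, ← hT] at h2
    linear_combination -h2 - h3
  have hfactor : ∀ t : ZMod p, (∏ y : (ZMod p)ˣ,
      if t ≠ 0 ∧ (t * (y : ZMod p)).val < (y : ZMod p).val then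
        (if B * (t * y) * y + C * (y : ZMod p) ^ 2 = 0 then 1
          else B * (t * y) * y + C * (y : ZMod p) ^ 2) else 1) =
      if B * t + C ∈ T then -(-1) ^ (p / 2) * (B * t + C) ^ (p / 2) else 1 := by
    intro t
    have hform : ∀ y : (ZMod p)ˣ, B * (t * y) * y + C * (y : ZMod p) ^ 2 =
        (y : ZMod p) ^ 2 * (B * t + C) := fun y => by ring
    have hmem : B * t + C ∈ T ↔ t ≠ 1 ∧ t ≠ 0 ∧ B * t + C ≠ 0 := by
      simp [hT, hB]
    simp only [hform, hmem]
    split_ifs with h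
    · obtain ⟨h1, h0, hu⟩ := h
      rw [← ZMod.prod_sq_mul_of_half_system hodd
        (Finset.univ.filter fun y : (ZMod p)ˣ => (t * (y : ZMod p)).val < (y : ZMod p).val)
        (fun y => by simpa using ZMod.val_mul_neg_lt_iff_s7 h0 h1 y), Finset.prod_filter]
      refine Finset.prod_congr rfl fun y _ => ?_
      simp [h0, hu]
    · refine Finset.prod_eq_one fun y _ => ?_
      split_ifs with h3 h4
      · rfl
      · refine absurd ⟨?_, h3.1, right_ne_zero_of_mul h4⟩ h
        rintro rfl
        simp at h3
      · rfl
  rw [ZMod.prod_Ico_Ico_eq (fun x y => if B * x * y + C * y ^ 2 = 0 then 1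
    else B * x * y + C * y ^ 2), Finset.prod_congr rfl fun t _ => hfactor t]
  have hbij : Function.Bijective fun t : ZMod p => B * t + C :=
    Finite.injective_iff_bijective.1 fun s t h => mul_left_cancel₀ hB (add_right_cancel h)
  rw [hbij.prod_comp (fun u => if u ∈ T then -(-1) ^ (p / 2) * u ^ (p / 2) else 1),
    Finset.prod_ite_mem, Finset.univ_inter, Finset.prod_mul_distrib, Finset.prod_const,
    hcard.neg_pow, ← pow_mul, mul_comm (p / 2), pow_mul, hcard.neg_one_pow, one_pow, one_mul,
    Finset.prod_pow]
  have hpow := congrArg (· ^ (p / 2)) hprod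
  simp only [mul_pow, one_pow] at hpow
  rcases ZMod.pow_div_two_eq_neg_one_or_one p (neg_ne_zero.2 (mul_ne_zero hC hBC)) with h | h <;>
    rw [h] at hpow ⊢
  · simpa using hpow
  · linear_combination -hpow

/-- Theorem 1.2, part of (1.9): for an odd prime `p` and integers `a, b, c` with
`p ∣ a` and `p ∤ bc(b+c)`, we have `S_p(a,b,c) ≡ ((-c(b+c))/p) (mod p)`, where
`S_p(a,b,c) = ∏_{1 ≤ i < j ≤ p-1, p ∤ ai²+bij+cj²} (ai² + bij + cj²)`. -/
theorem statement7 (p : ℕ) [Fact p.Prime] (hodd : Odd p) (a b c : ℤ)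
    (h1 : (p : ℤ) ∣ a) (h2 : ¬ (p : ℤ) ∣ b * c * (b + c)) :
    (∏ j ∈ Finset.Ico 1 p, ∏ i ∈ Finset.Ico 1 j,
        if (p : ℤ) ∣ (a * (i : ℤ) ^ 2 + b * (i : ℤ) * (j : ℤ) + c * (j : ℤ) ^ 2) then 1
        else a * (i : ℤ) ^ 2 + b * (i : ℤ) * (j : ℤ) + c * (j : ℤ) ^ 2)
      ≡ legendreSym p (-(c * (b + c))) [ZMOD (p : ℤ)] := by
  have hdvd : ∀ z : ℤ, (p : ℤ) ∣ z ↔ (z : ZMod p) = 0 := fun z =>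
    (ZMod.intCast_zmod_eq_zero_iff_dvd z p).symm
  rw [← ZMod.intCast_eq_intCast_iff, legendreSym.eq_pow]
  rw [hdvd] at h1 h2
  push_cast at h2
  obtain ⟨h3, hBC⟩ := mul_ne_zero_iff.1 h2
  obtain ⟨hB, hC⟩ := mul_ne_zero_iff.1 h3
  have h := ZMod.prod_Ico_Ico_bilinear hodd hB hC hBC
  simp only [hdvd]
  push_cast
  simpa only [h1, zero_mul, zero_add] using h
end

section
/- Let p be a prime with p ≡ 1 (mod 8) and let a, b be integers with ab ≡ −1 (mod p) and a ≡ b (mod p). Then {a,b}_p ≡ (−1)^{(p+7)/8} · ((p−1)/2)! (mod p). -/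
/-- The identity of `F` with the value at `0` replaced by `1`. -/
def nonzeroPart {F : Type*} [Field F] [DecidableEq F] (x : F) : F := if x = 0 then 1 else x

/-- `H` contains exactly one element of every pair `{x, -x}` of nonzero elements. -/
structure IsHalfSystem_s9 {F : Type*} [Field F] (H : Finset F) : Prop where
  neg_notMem : ∀ x ∈ H, -x ∉ H
  mem_or_neg_mem : ∀ x : F, x ≠ 0 → x ∈ H ∨ -x ∈ H

section NonzeroPart

variable {F : Type*} [Field F] [DecidableEq F]

lemma nonzeroPart_of_ne_zero {x : F} (hx : x ≠ 0) : nonzeroPart x = x := if_neg hx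

lemma nonzeroPart_neg {x : F} (hx : x ≠ 0) : nonzeroPart (-x) = -nonzeroPart x := by
  simp [nonzeroPart, hx]

lemma prod_nonzeroPart [Fintype F] : ∏ x : F, nonzeroPart x = -1 := by
  rw [← Finset.mul_prod_erase Finset.univ _ (Finset.mem_univ 0)]
  have h : ∏ x ∈ Finset.univ.erase (0 : F), nonzeroPart x = ∏ u : Fˣ, (u : F) := by
    symm
    refine Finset.prod_bij (fun u _ => (u : F)) (by simp)
      (fun _ _ _ _ h => Units.ext h) ?_ ?_
    · intro x hx
      exact ⟨Units.mk0 x (by simpa using hx), by simp, rfl⟩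
    · intro u _
      rw [nonzeroPart_of_ne_zero u.ne_zero]
  have hw := congrArg (Units.val) (FiniteField.prod_univ_units_id_eq_neg_one (K := F))
  rw [h]
  simpa [nonzeroPart] using hw

end NonzeroPart

namespace IsHalfSystem_s9

variable {F : Type*} [Field F] [DecidableEq F] {H : Finset F}

lemma ne_zero_s9 {F : Type*} [Field F] {H : Finset F} (hH : IsHalfSystem_s9 H) {x : F} (hx : x ∈ H) : x ≠ 0 := by
  rintro rfl
  exact hH.neg_notMem 0 hx (by simpa using hx)

lemma prod_univ [Fintype F] (hH : IsHalfSystem_s9 H) (f : F → F) :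
    ∏ x, f x = f 0 * ((∏ x ∈ H, f x) * ∏ x ∈ H, f (-x)) := by
  have hdisj : Disjoint H (H.image Neg.neg) := by
    rw [Finset.disjoint_left]
    intro x hx hx'
    obtain ⟨y, hy, rfl⟩ := Finset.mem_image.1 hx'
    exact hH.neg_notMem y hy hx
  have h : Finset.univ.erase (0 : F) = H ∪ H.image Neg.neg := by
    ext x
    simp only [Finset.mem_erase, Finset.mem_univ, and_true, Finset.mem_union, Finset.mem_image]
    constructor
    · intro hx
      exact (hH.mem_or_neg_mem x hx).imp_right fun h => ⟨-x, h, neg_neg x⟩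
    · rintro (hx | ⟨y, hy, rfl⟩)
      · exact hH.ne_zero_s9 hx
      · exact neg_ne_zero.2 (hH.ne_zero_s9 hy)
  rw [← Finset.mul_prod_erase Finset.univ _ (Finset.mem_univ 0), h, Finset.prod_union hdisj,
    Finset.prod_image (fun x _ y _ hxy => neg_injective hxy)]

lemma sq_prod [Fintype F] (hH : IsHalfSystem_s9 H) (hcard : Even H.card) :
    (∏ x ∈ H, x) ^ 2 = -1 := by
  have h := hH.prod_univ nonzeroPart
  have h1 : ∏ x ∈ H, nonzeroPart x = ∏ x ∈ H, x :=
    Finset.prod_congr rfl fun x hx => nonzeroPart_of_ne_zero (hH.ne_zero_s9 hx)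
  have h2 : ∏ x ∈ H, nonzeroPart (-x) = ∏ x ∈ H, x := by
    rw [← h1, Finset.prod_congr rfl fun x hx => nonzeroPart_neg (hH.ne_zero_s9 hx), Finset.prod_neg,
      hcard.neg_one_pow, one_mul]
  rw [prod_nonzeroPart, h1, h2] at h
  simpa [nonzeroPart, sq] using h.symm

lemma prod_nonzeroPart_sub_mul_add [Fintype F] (hH : IsHalfSystem_s9 H) (hcard : Even H.card)
    {c : F} (hc : c ∈ H) :
    (∏ i ∈ H, nonzeroPart (i - c) * nonzeroPart (i + c)) * c = 1 := by
  have h := hH.prod_univ fun x => nonzeroPart (x - c)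
  have h1 : ∏ x : F, nonzeroPart (x - c) = -1 := by
    rw [← prod_nonzeroPart (F := F)]
    exact Fintype.prod_equiv (Equiv.subRight c) _ _ fun _ => rfl
  have h2 : ∏ x ∈ H, nonzeroPart (-x - c) = ∏ x ∈ H, nonzeroPart (x + c) := by
    have : ∀ x ∈ H, nonzeroPart (-x - c) = -nonzeroPart (x + c) := by
      intro x hx
      rw [← nonzeroPart_neg, neg_add']
      intro h0
      exact hH.neg_notMem x hx (by rwa [neg_eq_of_add_eq_zero_right h0])
    rw [Finset.prod_congr rfl this, Finset.prod_neg, hcard.neg_one_pow, one_mul]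
  rw [h1, h2, zero_sub, nonzeroPart_of_ne_zero (neg_ne_zero.2 (hH.ne_zero_s9 hc)),
    ← Finset.prod_mul_distrib] at h
  linear_combination h

/-- The representative in `H` of the pair `{x, -x}`. -/
def rep (H : Finset F) (x : F) : F := if x ∈ H then x else -x

lemma rep_mem (hH : IsHalfSystem_s9 H) {x : F} (hx : x ≠ 0) : rep H x ∈ H := by
  unfold rep
  split_ifs with h
  · exact h
  · exact (hH.mem_or_neg_mem x hx).resolve_left h

lemma rep_mul_rep (hH : IsHalfSystem_s9 H) {a : F} (ha : a * a = -1) {x : F} (hx : x ∈ H) :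
    rep H (a * rep H (a * x)) = x := by
  have h1 : a * (a * x) = -x := by linear_combination x * ha
  have h2 : a * -(a * x) = x := by linear_combination -x * ha
  by_cases h : a * x ∈ H
  · simp [rep, h, h1, hH.neg_notMem x hx]
  · simp only [rep, h, if_false, h2, hx, if_true]

lemma prod_rep_mul (hH : IsHalfSystem_s9 H) {a : F} (ha : a * a = -1) :
    ∏ x ∈ H, rep H (a * x) = ∏ x ∈ H, x := by
  have ha0 : a ≠ 0 := by rintro rfl; simp at ha
  have hm : ∀ x ∈ H, rep H (a * x) ∈ H := fun x hx =>
    hH.rep_mem (mul_ne_zero ha0 (hH.ne_zero_s9 hx))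
  exact Finset.prod_nbij' (fun x => rep H (a * x)) (fun x => rep H (a * x)) hm hm
    (fun x hx => hH.rep_mul_rep ha hx) (fun x hx => hH.rep_mul_rep ha hx) fun _ _ => rfl

lemma prod_prod_nonzeroPart_sub_mul_add [Fintype F] (hH : IsHalfSystem_s9 H) (hcard : Even H.card)
    {a : F} (ha : a * a = -1) :
    ∏ j ∈ H, ∏ i ∈ H, nonzeroPart (i - a * j) * nonzeroPart (i + a * j) = -∏ x ∈ H, x := by
  have ha0 : a ≠ 0 := by rintro rfl; simp at ha
  have h : ∀ j ∈ H, (∏ i ∈ H, nonzeroPart (i - a * j) * nonzeroPart (i + a * j)) *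
      rep H (a * j) = 1 := by
    intro j hj
    rw [← hH.prod_nonzeroPart_sub_mul_add hcard
      (hH.rep_mem (mul_ne_zero ha0 (hH.ne_zero_s9 hj)))]
    congr 1
    refine Finset.prod_congr rfl fun i _ => ?_
    unfold rep
    split_ifs
    · rfl
    · rw [sub_neg_eq_add, ← sub_eq_add_neg, mul_comm]
  have h' := Finset.prod_congr rfl h
  rw [Finset.prod_mul_distrib, hH.prod_rep_mul ha, Finset.prod_const_one] at h'
  have hs := hH.sq_prod hcard
  generalize ∏ j ∈ H, ∏ i ∈ H, nonzeroPart (i - a * j) * nonzeroPart (i + a * j) = T at *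
  linear_combination -(∏ x ∈ H, x) * h' + T * hs

lemma two_mul_card_filter (hH : IsHalfSystem_s9 H) {a : F} (ha : a * a = -1) :
    2 * (H.filter fun j => -(a * j) ∈ H).card = H.card := by
  have ha0 : a ≠ 0 := by rintro rfl; simp at ha
  have h1 : ∀ x, a * (a * x) = -x := fun x => by linear_combination x * ha
  have hc : (H.filter fun j => ¬ -(a * j) ∈ H).card = (H.filter fun j => -(a * j) ∈ H).card := by
    have hiff : ∀ j ∈ H, (¬ -(a * j) ∈ H ↔ a * j ∈ H) := fun j hj =>
      ⟨fun h => (hH.mem_or_neg_mem _ (mul_ne_zero ha0 (hH.ne_zero_s9 hj))).resolve_right h,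
        hH.neg_notMem _⟩
    rw [Finset.filter_congr hiff]
    refine Finset.card_nbij' (fun j => a * j) (fun j => -(a * j)) ?_ ?_ ?_ ?_
    · intro j hj
      simp_all
    · intro j hj
      simp_all
    · intro j _
      simp [h1]
    · intro j _
      simp [h1]
  have := Finset.card_filter_add_card_filter_not (s := H) (fun j => -(a * j) ∈ H)
  omega

lemma nonzeroPart_sub_mul {a : F} (ha : a * a = -1) (i j : F) :
    nonzeroPart (j - a * i) =
      -a * (if i = -(a * j) then a else 1) * nonzeroPart (i + a * j) := by
  have ha0 : a ≠ 0 := by rintro rfl; simp at ha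
  have h : j - a * i = -a * (i + a * j) := by linear_combination j * ha
  rw [h]
  by_cases h0 : i + a * j = 0
  · rw [if_pos (eq_neg_of_add_eq_zero_left h0), h0]
    simp [nonzeroPart, ha]
  · rw [if_neg fun h => h0 (by rw [h, neg_add_cancel]), nonzeroPart_of_ne_zero h0,
      nonzeroPart_of_ne_zero (mul_ne_zero (neg_ne_zero.2 ha0) h0), mul_one]

lemma sq_prod_prod_nonzeroPart [Fintype F] (hH : IsHalfSystem_s9 H) {k : ℕ}
    (hcard : H.card = 4 * k) {a : F} (ha : a * a = -1) :
    (∏ i ∈ H, ∏ j ∈ H, nonzeroPart (i - a * j)) ^ 2 = (-1) ^ (k + 1) * ∏ x ∈ H, x := by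
  have hP : ∏ i ∈ H, ∏ j ∈ H, nonzeroPart (i - a * j) =
      (-1) ^ k * ∏ j ∈ H, ∏ i ∈ H, nonzeroPart (i + a * j) := by
    rw [Finset.prod_congr rfl fun j _ => Finset.prod_congr rfl fun i _ =>
      nonzeroPart_sub_mul ha i j]
    simp only [Finset.prod_mul_distrib, Finset.prod_const, Finset.prod_ite_eq', hcard]
    have h2 := hH.two_mul_card_filter ha
    have h3 : (H.filter fun j => -(a * j) ∈ H).card = 2 * k := by omega
    have h4 : ∏ j ∈ H, (if -(a * j) ∈ H then a else 1) = (-1) ^ k := by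
      rw [← Finset.prod_filter, Finset.prod_const, h3, pow_mul, sq, ha]
    have h5 : (-a) ^ (4 * k) = 1 := by
      rw [pow_mul, show (-a) ^ 4 = (a * a) ^ 2 by ring, ha]
      simp
    rw [h4, h5, one_pow, one_mul]
  have hT := hH.prod_prod_nonzeroPart_sub_mul_add (hcard ▸ ⟨2 * k, by ring⟩) ha
  simp only [Finset.prod_mul_distrib] at hT
  rw [Finset.prod_comm] at hT
  rw [sq]
  nth_rw 2 [hP]
  linear_combination (-1) ^ k * hT

end IsHalfSystem_s9

lemma injOn_natCast_Icc_half (p : ℕ) [Fact p.Prime] :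
    Set.InjOn (Nat.cast : ℕ → ZMod p) (Finset.Icc 1 ((p - 1) / 2)) := by
  have hp := (Fact.out : p.Prime).two_le
  intro x hx y hy h
  simp only [Finset.coe_Icc, Set.mem_Icc] at hx hy
  rw [ZMod.natCast_eq_natCast_iff'] at h
  rwa [Nat.mod_eq_of_lt (by omega), Nat.mod_eq_of_lt (by omega)] at h

lemma isHalfSystem_image_Icc {p : ℕ} [Fact p.Prime] (hp : Odd p) :
    IsHalfSystem_s9 ((Finset.Icc 1 ((p - 1) / 2)).image (Nat.cast : ℕ → ZMod p)) where
  neg_notMem := by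
    intro x hx hx'
    simp only [Finset.mem_image, Finset.mem_Icc] at hx hx'
    obtain ⟨m, hm, rfl⟩ := hx
    obtain ⟨l, hl, h⟩ := hx'
    have h0 : ((m + l : ℕ) : ZMod p) = 0 := by push_cast; rw [h, add_neg_cancel]
    have := Nat.le_of_dvd (by omega) ((ZMod.natCast_eq_zero_iff _ _).1 h0)
    omega
  mem_or_neg_mem := by
    intro x hx
    have hlt := ZMod.val_lt x
    have hpos : x.val ≠ 0 := (ZMod.val_ne_zero x).2 hx
    obtain ⟨t, ht⟩ := hp
    simp only [Finset.mem_image, Finset.mem_Icc]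
    by_cases h : x.val ≤ (p - 1) / 2
    · exact Or.inl ⟨x.val, ⟨by omega, h⟩, ZMod.natCast_zmod_val x⟩
    · refine Or.inr ⟨p - x.val, ⟨by omega, by omega⟩, ?_⟩
      rw [Nat.cast_sub hlt.le]
      simp

/-- Theorem 1.3(ii), first part: let `p ≡ 1 (mod 8)` be a prime and `a, b` integers
with `ab ≡ -1 (mod p)` and `a ≡ b (mod p)`. Then
`{a,b}_p ≡ (-1)^{(p+7)/8} · ((p-1)/2)! (mod p)`, where
`{a,b}_p = ∏_{1 ≤ i,j ≤ (p-1)/2, i ≢ aj, i ≢ bj (mod p)} (i - aj)(i - bj)`. -/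
theorem statement9 (p : ℕ) [Fact p.Prime] (hp : p % 8 = 1) (a b : ℤ)
    (hab : a * b ≡ -1 [ZMOD (p : ℤ)]) (hEq : a ≡ b [ZMOD (p : ℤ)]) :
    (∏ i ∈ Finset.Icc 1 ((p - 1) / 2), ∏ j ∈ Finset.Icc 1 ((p - 1) / 2),
        if (p : ℤ) ∣ (i : ℤ) - a * (j : ℤ) ∨ (p : ℤ) ∣ (i : ℤ) - b * (j : ℤ) then 1
        else ((i : ℤ) - a * (j : ℤ)) * ((i : ℤ) - b * (j : ℤ)))
      ≡ (-1) ^ ((p + 7) / 8) * (Nat.factorial ((p - 1) / 2) : ℤ) [ZMOD (p : ℤ)] := by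
  have hba : (b : ZMod p) = a := ((ZMod.intCast_eq_intCast_iff a b p).2 hEq).symm
  have ha : (a : ZMod p) * a = -1 := by
    have h := (ZMod.intCast_eq_intCast_iff _ _ p).2 hab
    push_cast at h
    rwa [hba] at h
  have hH := isHalfSystem_image_Icc (p := p) (Nat.odd_iff.2 (by omega))
  have hinj := injOn_natCast_Icc_half p
  have hcard : ((Finset.Icc 1 ((p - 1) / 2)).image (Nat.cast : ℕ → ZMod p)).card =
      4 * (p / 8) := by
    rw [Finset.card_image_of_injOn hinj, Nat.card_Icc]
    omega
  have main := hH.sq_prod_prod_nonzeroPart hcard ha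
  simp only [Finset.prod_image hinj] at main
  rw [← ZMod.intCast_eq_intCast_iff, show (p + 7) / 8 = p / 8 + 1 by omega]
  push_cast
  rw [← Finset.prod_Ico_id_eq_factorial, Nat.cast_prod, Finset.Ico_add_one_right_eq_Icc,
    ← main, ← Finset.prod_pow]
  refine Finset.prod_congr rfl fun i _ => ?_
  rw [← Finset.prod_pow]
  refine Finset.prod_congr rfl fun j _ => ?_
  simp only [← ZMod.intCast_zmod_eq_zero_iff_dvd]
  push_cast
  simp only [hba, or_self, nonzeroPart]
  split_ifs
  · simp
  · rw [sq]
end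

section
/- Let p be a prime with p ≡ 5 (mod 8), let k ∈ {0, 1}, and let a, b be integers with ab ≡ −1 (mod p) and a ≡ b ≡ (−1)^k · ((p−1)/2)! (mod p). Then {a,b}_p ≡ (−1)^{k + (p−5)/8} (mod p). -/
/-- The numbers `±1, …, ±(p-1)/2` represent every nonzero residue class modulo `p` once. -/
@[to_additive]
theorem prod_half_mul_neg {M : Type*} [CommMonoid M] (p : ℕ) [Fact p.Prime] (hp : p % 2 = 1)
    (g : ZMod p → M) :
    ∏ i ∈ Finset.Icc 1 ((p - 1) / 2), (g (i : ZMod p) * g (-(i : ZMod p))) =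
      ∏ x ∈ Finset.univ.erase (0 : ZMod p), g x := by
  have hpos : 0 < p := (Fact.out : p.Prime).pos
  have hneg : ∏ i ∈ Finset.Icc 1 ((p - 1) / 2), g (-(i : ZMod p)) =
      ∏ i ∈ Finset.Ioc ((p - 1) / 2) (p - 1), g (i : ZMod p) := by
    refine Finset.prod_nbij' (fun i => p - i) (fun i => p - i) ?_ ?_ ?_ ?_ ?_
    · intro i hi; simp only [Finset.mem_Icc, Finset.mem_Ioc] at *; omega
    · intro i hi; simp only [Finset.mem_Icc, Finset.mem_Ioc] at *; omega
    · intro i hi; simp only [Finset.mem_Icc] at *; omega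
    · intro i hi; simp only [Finset.mem_Ioc] at *; omega
    · intro i hi
      simp only [Finset.mem_Icc] at hi
      rw [Nat.cast_sub (by omega)]
      simp
  have hunion : Finset.Icc 1 (p - 1) =
      Finset.Icc 1 ((p - 1) / 2) ∪ Finset.Ioc ((p - 1) / 2) (p - 1) := by
    ext i; simp only [Finset.mem_union, Finset.mem_Icc, Finset.mem_Ioc]; omega
  have hdisj : Disjoint (Finset.Icc 1 ((p - 1) / 2)) (Finset.Ioc ((p - 1) / 2) (p - 1)) := by
    rw [Finset.disjoint_left]
    intro i; simp only [Finset.mem_Icc, Finset.mem_Ioc]; omega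
  rw [Finset.prod_mul_distrib, hneg, ← Finset.prod_union hdisj, ← hunion]
  refine Finset.prod_nbij' (fun i => (i : ZMod p)) ZMod.val ?_ ?_ ?_ ?_ ?_
  · intro i hi
    simp only [Finset.mem_Icc] at hi
    simp only [Finset.mem_erase, Finset.mem_univ, and_true, ne_eq,
      ZMod.natCast_eq_zero_iff]
    exact fun h => by have := Nat.le_of_dvd (by omega) h; omega
  · intro x hx
    simp only [Finset.mem_erase, Finset.mem_univ, and_true] at hx
    have h1 := ZMod.val_lt x
    have h2 : x.val ≠ 0 := by simpa using hx
    simp only [Finset.mem_Icc]; omega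
  · intro i hi
    simp only [Finset.mem_Icc] at hi
    exact ZMod.val_cast_of_lt (by omega)
  · intro x _; simp
  · intro i _; rfl

theorem prod_Icc_natCast_eq_factorial {R : Type*} [CommSemiring R] (n : ℕ) :
    ∏ i ∈ Finset.Icc 1 n, (i : R) = n.factorial := by
  induction n with
  | zero => simp
  | succ n ih =>
    rw [Finset.prod_Icc_succ_top (by omega), ih, Nat.factorial_succ, Nat.cast_mul, mul_comm]

/-- The identity on a type with zero, except that zero is sent to one. -/
def zeroToOne {F : Type*} [Zero F] [One F] [DecidableEq F] (x : F) : F := if x = 0 then 1 else x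

theorem zeroToOne_mul {F : Type*} [Field F] [DecidableEq F] {c : F} (hc : c ≠ 0) (x : F) :
    zeroToOne (c * x) = c ^ (if x = 0 then 0 else 1) * zeroToOne x := by
  by_cases hx : x = 0 <;> simp [zeroToOne, hx, hc]

/-- If `((p-1)/2)!² = -1` and `(p-1)/2` is even, then the product of `x - c` over all `x ≠ 0, c`
is `c⁻¹`. -/
theorem prod_zeroToOne_sub (p : ℕ) [Fact p.Prime] (hp : p % 4 = 1)
    (hfact : (((p - 1) / 2).factorial : ZMod p) ^ 2 = -1) {c : ZMod p} (hc : c ≠ 0) :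
    (∏ x ∈ Finset.univ.erase (0 : ZMod p), zeroToOne (x - c)) * c = 1 := by
  have h1 : ∏ x : ZMod p, zeroToOne (x - c) = ∏ x : ZMod p, zeroToOne x :=
    Fintype.prod_equiv (Equiv.subRight c) _ _ fun _ => rfl
  have h2 : ∏ x : ZMod p, zeroToOne x = -1 := by
    rw [← Finset.mul_prod_erase _ _ (Finset.mem_univ (0 : ZMod p))]
    have h3 : ∏ x ∈ Finset.univ.erase (0 : ZMod p), zeroToOne x =
        ∏ x ∈ Finset.univ.erase (0 : ZMod p), x :=
      Finset.prod_congr rfl fun x hx => if_neg (Finset.ne_of_mem_erase hx)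
    rw [h3, ← prod_half_mul_neg p (by omega) (fun x => x)]
    have heven : Even ((p - 1) / 2) := by rw [Nat.even_iff]; omega
    rw [Finset.prod_mul_distrib, Finset.prod_neg, prod_Icc_natCast_eq_factorial, Nat.card_Icc, Nat.add_sub_cancel,
      heven.neg_one_pow, one_mul, ← sq, hfact]
    simp [zeroToOne]
  rw [h2, ← Finset.mul_prod_erase _ _ (Finset.mem_univ (0 : ZMod p))] at h1
  have h5 : zeroToOne (0 - c) = -c := by simp [zeroToOne, hc]
  rw [h5] at h1
  linear_combination -h1

/-- The square of the product of the nonzero `i - a j`, for `a² = -1`, `p ≡ 5 (mod 8)` and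
`1 ≤ i, j ≤ (p-1)/2`, up to the factor `((p-1)/2)!`. -/
theorem sq_prod_zeroToOne_sub_mul (p m : ℕ) [Fact p.Prime] (hp : p = 8 * m + 5)
    (hfact : (((p - 1) / 2).factorial : ZMod p) ^ 2 = -1) {a : ZMod p} (ha : a ^ 2 = -1) :
    (∏ i ∈ Finset.Icc 1 ((p - 1) / 2), ∏ j ∈ Finset.Icc 1 ((p - 1) / 2),
      zeroToOne ((i : ZMod p) - a * j)) ^ 2 * ((p - 1) / 2).factorial = (-1) ^ m * a := by
  have ha0 : a ≠ 0 := by rintro rfl; norm_num at ha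
  have hn : (p - 1) / 2 = 4 * m + 2 := by omega
  set n := (p - 1) / 2 with hn_def
  have hj0 : ∀ j ∈ Finset.Icc 1 n, (j : ZMod p) ≠ 0 := by
    intro j hj
    simp only [Finset.mem_Icc] at hj
    rw [ne_eq, ZMod.natCast_eq_zero_iff]
    exact fun h => by have := Nat.le_of_dvd (by omega) h; omega
  have hrot : ∀ i j : ℕ, (i : ZMod p) - a * j = a * (-(j : ZMod p) - a * i) := fun i j => by
    linear_combination (i : ZMod p) * ha
  set P := ∏ i ∈ Finset.Icc 1 n, ∏ j ∈ Finset.Icc 1 n, zeroToOne ((i : ZMod p) - a * j) with hP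
  set R := ∏ j ∈ Finset.Icc 1 n, ∏ i ∈ Finset.Icc 1 n, zeroToOne (-(i : ZMod p) - a * j) with hR
  set M := ∑ j ∈ Finset.Icc 1 n, ∑ i ∈ Finset.Icc 1 n,
    (if -(i : ZMod p) - a * j = 0 then 0 else 1) with hM
  have hPR : P = a ^ M * R := by
    simp only [hP, hR, hM, hrot, zeroToOne_mul ha0, Finset.prod_mul_distrib,
      Finset.prod_pow_eq_pow_sum]
  have hprod : P * R * (a ^ n * n.factorial) = 1 := by
    have h4 : a ^ n * (n.factorial : ZMod p) = ∏ j ∈ Finset.Icc 1 n, (a * (j : ZMod p)) := by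
      rw [Finset.prod_mul_distrib, prod_Icc_natCast_eq_factorial]
      simp
    rw [hP, hR, Finset.prod_comm, ← Finset.prod_mul_distrib, h4, ← Finset.prod_mul_distrib]
    refine Finset.prod_eq_one fun j hj => ?_
    rw [← Finset.prod_mul_distrib,
      prod_half_mul_neg p (by omega) (fun x => zeroToOne (x - a * (j : ZMod p)))]
    exact prod_zeroToOne_sub p (by omega) hfact (mul_ne_zero ha0 (hj0 j hj))
  have hcount : 2 * M = n * (p - 2) := by
    have hM' : M = ∑ j ∈ Finset.Icc 1 n, ∑ i ∈ Finset.Icc 1 n,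
        (if (i : ZMod p) - a * j = 0 then 0 else 1) := by
      rw [hM, Finset.sum_comm]
      simp only [hrot, mul_eq_zero, ha0, false_or]
    rw [two_mul]
    nth_rw 1 [hM']
    rw [hM, ← Finset.sum_add_distrib]
    have : ∀ j ∈ Finset.Icc 1 n, (∑ i ∈ Finset.Icc 1 n,
        (if (i : ZMod p) - a * j = 0 then 0 else 1) + ∑ i ∈ Finset.Icc 1 n,
        (if -(i : ZMod p) - a * j = 0 then 0 else 1)) = p - 2 := by
      intro j hj
      rw [← Finset.sum_add_distrib, sum_half_add_neg p (by omega)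
        (fun x => if x - a * (j : ZMod p) = 0 then 0 else 1)]
      have hmem : a * (j : ZMod p) ∈ Finset.univ.erase (0 : ZMod p) := by
        simpa using ⟨ha0, hj0 j hj⟩
      rw [← Finset.add_sum_erase _ _ hmem, Finset.sum_congr rfl (g := fun _ => 1)
        fun x hx => if_neg (sub_ne_zero.2 (Finset.ne_of_mem_erase hx))]
      simp [Finset.card_erase_of_mem hmem, Finset.card_erase_of_mem, ZMod.card]
      omega
    rw [Finset.sum_congr rfl this]
    simp
  have hMval : M = 2 * (8 * m ^ 2 + 7 * m + 1) + 1 := by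
    have : p - 2 = 8 * m + 3 := by omega
    rw [hn, this] at hcount
    nlinarith
  have haM : a ^ M = (-1) ^ (m + 1) * a := by
    have : (8 * m ^ 2 + 7 * m + 1) = 2 * (4 * m ^ 2 + 3 * m) + (m + 1) := by ring
    rw [hMval, pow_succ, pow_mul, ha, this, pow_add, pow_mul]
    simp
  have han : a ^ n = -1 := by
    rw [hn, show 4 * m + 2 = 2 * (2 * m + 1) by ring, pow_mul, ha, pow_succ, pow_mul]
    simp
  rw [han] at hprod
  have : P ^ 2 * n.factorial = - (a ^ M * (P * R * (-1 * n.factorial))) := by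
    nth_rw 1 [sq, hPR]
    ring
  rw [this, hprod, haM]
  ring


/-- Theorem 1.3(ii), second part: let `p ≡ 5 (mod 8)` be a prime, `k ∈ {0,1}`, and
`a, b` integers with `ab ≡ -1 (mod p)` and `a ≡ b ≡ (-1)^k ((p-1)/2)! (mod p)`. Then
`{a,b}_p ≡ (-1)^{k + (p-5)/8} (mod p)`, where
`{a,b}_p = ∏_{1 ≤ i,j ≤ (p-1)/2, i ≢ aj, i ≢ bj (mod p)} (i - aj)(i - bj)`. -/
theorem statement10 (p : ℕ) [Fact p.Prime] (hp : p % 8 = 5) (k : ℕ) (hk : k = 0 ∨ k = 1)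
    (a b : ℤ) (hab : a * b ≡ -1 [ZMOD (p : ℤ)])
    (ha : a ≡ (-1) ^ k * (Nat.factorial ((p - 1) / 2) : ℤ) [ZMOD (p : ℤ)])
    (hb : b ≡ (-1) ^ k * (Nat.factorial ((p - 1) / 2) : ℤ) [ZMOD (p : ℤ)]) :
    (∏ i ∈ Finset.Icc 1 ((p - 1) / 2), ∏ j ∈ Finset.Icc 1 ((p - 1) / 2),
        if (p : ℤ) ∣ (i : ℤ) - a * (j : ℤ) ∨ (p : ℤ) ∣ (i : ℤ) - b * (j : ℤ) then 1
        else ((i : ℤ) - a * (j : ℤ)) * ((i : ℤ) - b * (j : ℤ)))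
      ≡ (-1) ^ (k + (p - 5) / 8) [ZMOD (p : ℤ)] := by
  obtain ⟨m, hm⟩ : ∃ m, p = 8 * m + 5 := ⟨p / 8, by omega⟩
  have hm' : (p - 5) / 8 = m := by omega
  rw [hm', ← ZMod.intCast_eq_intCast_iff]
  rw [← ZMod.intCast_eq_intCast_iff] at hab ha hb
  push_cast at hab ha hb ⊢
  rw [hb, ← ha] at hab
  have hε : ((-1 : ZMod p) ^ k) ^ 2 = 1 := by rw [← pow_mul, mul_comm, pow_mul]; simp
  have hsq : (a : ZMod p) ^ 2 = -1 := by rw [sq, hab]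
  have hfact : (((p - 1) / 2).factorial : ZMod p) ^ 2 = -1 := by
    rw [ha, mul_pow, hε, one_mul] at hsq
    exact hsq
  have ha0 : (a : ZMod p) ≠ 0 := by intro h; rw [h] at hsq; norm_num at hsq
  have key := sq_prod_zeroToOne_sub_mul p m hm hfact hsq
  have hprod : (∏ i ∈ Finset.Icc 1 ((p - 1) / 2), ∏ j ∈ Finset.Icc 1 ((p - 1) / 2),
      (((if (p : ℤ) ∣ (i : ℤ) - a * (j : ℤ) ∨ (p : ℤ) ∣ (i : ℤ) - b * (j : ℤ) then 1
        else ((i : ℤ) - a * (j : ℤ)) * ((i : ℤ) - b * (j : ℤ)) : ℤ)) : ZMod p)) =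
      (∏ i ∈ Finset.Icc 1 ((p - 1) / 2), ∏ j ∈ Finset.Icc 1 ((p - 1) / 2),
        zeroToOne ((i : ZMod p) - a * j)) ^ 2 := by
    simp only [← Finset.prod_pow]
    refine Finset.prod_congr rfl fun i _ => Finset.prod_congr rfl fun j _ => ?_
    have hba : (b : ZMod p) = a := hb.trans ha.symm
    simp only [← ZMod.intCast_zmod_eq_zero_iff_dvd]
    push_cast
    simp only [hba, or_self, zeroToOne]
    split_ifs
    · simp
    · ring
  push_cast at hprod
  rw [hprod]
  have hfa : (((p - 1) / 2).factorial : ZMod p) = (-1) ^ k * a := by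
    rw [ha, ← mul_assoc, ← sq, hε, one_mul]
  rw [hfa] at key
  apply mul_right_cancel₀ ha0
  rw [pow_add]
  linear_combination (-1 : ZMod p) ^ k * key - (∏ i ∈ Finset.Icc 1 ((p - 1) / 2),
    ∏ j ∈ Finset.Icc 1 ((p - 1) / 2), zeroToOne ((i : ZMod p) - a * j)) ^ 2 * a * hε
end
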